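/- Let F_n be the free group of finite rank n. For every endomorphism φ of F_n, the fixed subgroup Fix(φ) = {g ∈ F_n : φ(g) = g} is finitely generated and has rank at most n. -/

import Mathlib

/-- The fixed subgroup of an endomorphism. -/
def fixedSubgroup {G : Type*} [Group G] (φ : G →* G) : Subgroup G where
  carrier := {g | φ g = g}
  one_mem' := by simp
  mul_mem' := by
    intro a b ha hb
    simp only [Set.mem_setOf_eq, map_mul] at *
    rw [ha, hb]
  inv_mem' := by
    intro a ha
    simp only [Set.mem_setOf_eq, map_inv] at *
    rw [ha]

open MonoidAlgebra

section CrossedHom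

variable {X S A : Type*} [Ring S] [AddCommGroup A] [Module S A]

/-- The affine permutation of `A` attached to a generator. -/
def affinePerm (ρ : FreeGroup X →* S) (a : X → A) (x : X) : Equiv.Perm A where
  toFun v := a x + ρ (.of x) • v
  invFun v := ρ (.of x)⁻¹ • (v - a x)
  left_inv v := by simp [← mul_smul, ← map_mul]
  right_inv v := by simp [← mul_smul, ← map_mul]

/-- The crossed homomorphism `D (f * g) = D f + f • D g` with prescribed values on the basis. -/
def crossed (ρ : FreeGroup X →* S) (a : X → A) (f : FreeGroup X) : A :=
  FreeGroup.lift (affinePerm ρ a) f 0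

variable (ρ : FreeGroup X →* S) (a : X → A)

@[simp] lemma crossed_one : crossed ρ a 1 = 0 := by simp [crossed]

@[simp] lemma crossed_of (x : X) : crossed ρ a (.of x) = a x := by
  simp [crossed, affinePerm]

lemma lift_affinePerm (f : FreeGroup X) (v : A) :
    FreeGroup.lift (affinePerm ρ a) f v = crossed ρ a f + ρ f • v := by
  induction f using FreeGroup.induction_on generalizing v with
  | C1 => simp
  | of x => simp [affinePerm]
  | inv_of x _ =>
    simp only [crossed, map_inv, FreeGroup.lift_apply_of]
    simp [affinePerm, Equiv.Perm.inv_def, sub_eq_add_neg, add_comm]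
  | mul f g hf hg =>
    simp only [crossed, map_mul, Equiv.Perm.mul_apply]
    rw [hf, hg, hf (FreeGroup.lift (affinePerm ρ a) g 0), hg 0]
    simp [smul_add, mul_smul, add_assoc]

lemma crossed_mul (f g : FreeGroup X) :
    crossed ρ a (f * g) = crossed ρ a f + ρ f • crossed ρ a g := by
  conv_lhs => rw [crossed, map_mul, Equiv.Perm.mul_apply, lift_affinePerm]
  rfl

lemma crossed_inv (f : FreeGroup X) : crossed ρ a f⁻¹ = -(ρ f⁻¹ • crossed ρ a f) := by
  have := crossed_mul ρ a f⁻¹ f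
  rw [inv_mul_cancel, crossed_one] at this
  exact eq_neg_of_add_eq_zero_left this.symm

/-- Two crossed homomorphisms which agree on the basis are equal. -/
lemma crossed_unique {D E : FreeGroup X → A} (hD : ∀ f g, D (f * g) = D f + ρ f • D g)
    (hE : ∀ f g, E (f * g) = E f + ρ f • E g) (h : ∀ x, D (.of x) = E (.of x)) : D = E := by
  have one : ∀ D : FreeGroup X → A, (∀ f g, D (f * g) = D f + ρ f • D g) → D 1 = 0 := by
    intro D hD
    have := hD 1 1
    simpa using this
  have inv : ∀ D : FreeGroup X → A, (∀ f g, D (f * g) = D f + ρ f • D g) →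
      ∀ f, D f⁻¹ = -(ρ f⁻¹ • D f) := by
    intro D hD f
    have := hD f⁻¹ f
    rw [inv_mul_cancel, one D hD] at this
    exact eq_neg_of_add_eq_zero_left this.symm
  funext f
  induction f using FreeGroup.induction_on with
  | C1 => rw [one D hD, one E hE]
  | of x => exact h x
  | inv_of x hx => rw [inv D hD, inv E hE]; simp [h]
  | mul f g hf hg => rw [hD, hE, hf, hg]

end CrossedHom

section LinExt

variable {R G A : Type*} [CommRing R] [AddCommGroup A] [Module R A]

/-- Linear extension of a function on `G` to the group algebra. -/
noncomputable def linExt (f : G → A) : MonoidAlgebra R G →ₗ[R] A where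
  toFun a := Finsupp.linearCombination R f a.coeff
  map_add' a b := by simp
  map_smul' r a := by simp

@[simp] lemma linExt_single (f : G → A) (g : G) (r : R) :
    linExt f (single g r) = r • f g := by simp [linExt]

lemma linExt_apply (f : G → A) (a : MonoidAlgebra R G) :
    linExt f a = a.coeff.sum fun g r => r • f g := rfl

lemma algebra_hom_ext {f g : MonoidAlgebra R G →ₗ[R] A}
    (h : ∀ x, f (single x 1) = g (single x 1)) : f = g := by
  refine LinearMap.ext fun a => ?_
  induction a using MonoidAlgebra.induction_linear with
  | zero => simp
  | add a b ha hb => simp [ha, hb]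
  | single x r =>
    have : (single x r : MonoidAlgebra R G) = r • single x 1 := by simp
    rw [this, map_smul, map_smul, h]

end LinExt

section Fox

variable {R : Type*} [CommRing R] {X : Type*}

/-- Augmentation. -/
noncomputable def aug (R G : Type*) [CommRing R] [Group G] : MonoidAlgebra R G →ₐ[R] R :=
  MonoidAlgebra.lift R R G 1

@[simp] lemma aug_single {G : Type*} [Group G] (g : G) (r : R) : aug R G (single g r) = r := by
  simp [aug]

/-- Fox derivative of a group element. -/
noncomputable def fox (R : Type*) [CommRing R] {X : Type*} [DecidableEq X] (j : X)
    (f : FreeGroup X) : MonoidAlgebra R (FreeGroup X) :=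
  crossed (MonoidAlgebra.of R (FreeGroup X)) (fun l => if l = j then 1 else 0) f

variable [DecidableEq X]

@[simp] lemma fox_one (j : X) : fox R j 1 = 0 := crossed_one ..

lemma fox_of (j l : X) : fox R j (.of l) = if l = j then 1 else 0 := crossed_of ..

lemma fox_mul (j : X) (f g : FreeGroup X) : fox R j (f * g) = fox R j f + single f 1 * fox R j g :=
  crossed_mul ..

/-- Fox derivative on the group algebra. -/
noncomputable def dfox (j : X) :
    MonoidAlgebra R (FreeGroup X) →ₗ[R] MonoidAlgebra R (FreeGroup X) :=
  linExt (fox R j)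

@[simp] lemma dfox_single (j : X) (f : FreeGroup X) (r : R) :
    dfox j (single f r) = r • fox R j f := linExt_single ..

@[simp] lemma dfox_one (j : X) : dfox j (1 : MonoidAlgebra R (FreeGroup X)) = 0 := by
  simp [one_def]

lemma dfox_mul (j : X) (a b : MonoidAlgebra R (FreeGroup X)) :
    dfox j (a * b) = aug R _ b • dfox j a + a * dfox j b := by
  induction a using MonoidAlgebra.induction_linear with
  | zero => simp
  | add a a' h h' => simp only [add_mul, map_add, h, h', smul_add]; abel
  | single x r =>
    induction b using MonoidAlgebra.induction_linear with
    | zero => simp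
    | add a a' h h' => simp only [mul_add, map_add, h, h', add_smul]; abel
    | single y s =>
      simp only [single_mul_single, dfox_single, fox_mul, aug_single, smul_add, smul_smul,
        mul_comm s r, mul_smul_comm]
      congr 1
      rw [mul_smul, smul_comm, ← smul_mul_assoc]
      simp

lemma fox_fundamental [Fintype X] (f : FreeGroup X) :
    (single f 1 - 1 : MonoidAlgebra R (FreeGroup X)) =
      ∑ j, fox R j f * (single (.of j) 1 - 1) := by
  refine congrFun (crossed_unique (MonoidAlgebra.of R (FreeGroup X))
    (D := fun f => (single f 1 - 1 : MonoidAlgebra R (FreeGroup X)))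
    (E := fun f => ∑ j, fox R j f * (single (.of j) 1 - 1)) ?_ ?_ ?_) f
  · intro f g
    simp [mul_sub, single_mul_single]
  · intro f g
    simp [fox_mul, add_mul, Finset.sum_add_distrib, Finset.mul_sum, mul_assoc]
  · intro x
    simp [fox_of, ite_mul]

lemma dfox_fundamental [Fintype X] (a : MonoidAlgebra R (FreeGroup X)) :
    a = algebraMap R _ (aug R _ a) + ∑ j, dfox j a * (single (.of j) 1 - 1) := by
  induction a using MonoidAlgebra.induction_linear with
  | zero => simp
  | add a b h h' =>
    simp only [map_add, add_mul, Finset.sum_add_distrib]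
    nth_rewrite 1 [h]
    nth_rewrite 1 [h']
    abel
  | single f r =>
    have : (single f r : MonoidAlgebra R (FreeGroup X)) = r • 1 + r • (single f 1 - 1) := by
      simp [smul_sub]
    rw [aug_single]
    nth_rewrite 1 [this]
    rw [fox_fundamental]
    simp [Algebra.algebraMap_eq_smul_one, Finset.smul_sum]

/-- The map of group algebras induced by a group homomorphism. -/
noncomputable def gmap (R : Type*) [CommRing R] {G H : Type*} [Group G] [Group H] (ψ : G →* H) :
    MonoidAlgebra R G →ₐ[R] MonoidAlgebra R H :=
  mapDomainAlgHom R R ψ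

@[simp] lemma gmap_single {G H : Type*} [Group G] [Group H] (ψ : G →* H) (g : G) (r : R) :
    gmap R ψ (single g r) = single (ψ g) r := by
  simp [gmap]

lemma gmap_apply {G H : Type*} [Group G] [Group H] (ψ : G →* H) (a : MonoidAlgebra R G) :
    gmap R ψ a = mapDomain ψ a := rfl

lemma gmap_gmap {G H K : Type*} [Group G] [Group H] [Group K] (ψ : G →* H) (χ : H →* K)
    (a : MonoidAlgebra R G) : gmap R χ (gmap R ψ a) = gmap R (χ.comp ψ) a := by
  induction a using MonoidAlgebra.induction_linear with
  | zero => simp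
  | add a b h h' => simp only [map_add, h, h']
  | single f r => simp

@[simp] lemma aug_gmap {G H : Type*} [Group G] [Group H] (ψ : G →* H) (a : MonoidAlgebra R G) :
    aug R H (gmap R ψ a) = aug R G a := by
  induction a using MonoidAlgebra.induction_linear with
  | zero => simp
  | add a b h h' => simp only [map_add, h, h']
  | single f r => simp

lemma fox_map [Fintype X] {Z : Type*} [DecidableEq Z] (ψ : FreeGroup X →* FreeGroup Z)
    (l : Z) (f : FreeGroup X) :
    fox R l (ψ f) = ∑ j, gmap R ψ (fox R j f) * fox R l (ψ (.of j)) := by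
  refine congrFun (crossed_unique ((MonoidAlgebra.of R (FreeGroup Z)).comp ψ)
    (D := fun f => fox R l (ψ f))
    (E := fun f => ∑ j, gmap R ψ (fox R j f) * fox R l (ψ (.of j))) ?_ ?_ ?_) f
  · intro f g
    simp [fox_mul]
  · intro f g
    simp [fox_mul, add_mul, Finset.sum_add_distrib, Finset.mul_sum, mul_assoc]
  · intro x
    simp [fox_of, apply_ite (gmap R ψ)]

lemma dfox_gmap [Fintype X] {Z : Type*} [DecidableEq Z] (ψ : FreeGroup X →* FreeGroup Z)
    (l : Z) (a : MonoidAlgebra R (FreeGroup X)) :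
    dfox l (gmap R ψ a) = ∑ j, gmap R ψ (dfox j a) * fox R l (ψ (.of j)) := by
  induction a using MonoidAlgebra.induction_linear with
  | zero => simp
  | add a b h h' => simp only [map_add, h, h', add_mul, Finset.sum_add_distrib]
  | single f r => simp [fox_map ψ l f, Finset.smul_sum]

end Fox

section Minkowski

variable {A : Type*} [AddCommGroup A]

lemma pow_sub_mem_smul {W : Submodule ℤ A} {T : Module.End ℤ A} {p : ℤ}
    (hT : ∀ w ∈ W, ∃ v ∈ W, T w - w = p • v) (k : ℕ) :
    ∀ w ∈ W, ∃ v ∈ W, (T ^ k) w - w = p • v := by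
  induction k with
  | zero => exact fun w _ => ⟨0, W.zero_mem, by simp⟩
  | succ k ih =>
    intro w hw
    obtain ⟨v, hv, h1⟩ := ih w hw
    obtain ⟨v', hv', h2⟩ := hT w hw
    obtain ⟨v'', hv'', h3⟩ := ih v' hv'
    refine ⟨v + (v' + p • v''), W.add_mem hv (W.add_mem hv' (W.smul_mem _ hv'')), ?_⟩
    have h4 : (T ^ k) v' = v' + p • v'' := by rw [← h3]; abel
    rw [pow_succ, Module.End.mul_apply, eq_add_of_sub_eq h2, map_add, map_smul, h4]
    rw [eq_add_of_sub_eq h1]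
    module

lemma eq_self_of_pow_eq_self {W : Submodule ℤ A} {T : Module.End ℤ A} {p : ℕ} (hp : p.Prime)
    (tf : ∀ (n : ℤ) (a : A), n ≠ 0 → n • a = 0 → a = 0)
    (sep : ∀ a : A, (∀ s : ℕ, ∃ b, a = ((p : ℤ) ^ s) • b) → a = 0)
    (hT : ∀ w ∈ W, ∃ v ∈ W, T w - w = (p : ℤ) • v) {r : ℕ} (hr : ¬ p ∣ r)
    (hTr : ∀ w ∈ W, (T ^ r) w = w) : ∀ w ∈ W, T w = w := by
  have key : ∀ s : ℕ, ∀ w ∈ W, ∃ v ∈ W, T w - w = ((p : ℤ) ^ s) • v := by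
    intro s
    induction s with
    | zero =>
      intro w hw
      obtain ⟨v, hv, h⟩ := hT w hw
      exact ⟨(p : ℤ) • v, W.smul_mem _ hv, by rw [h]; simp⟩
    | succ s ih =>
      intro w hw
      obtain ⟨v, hv, h⟩ := ih w hw
      choose! g hg hg' using fun k => pow_sub_mem_smul hT k v hv
      have tel : (T ^ r) w - w = ∑ k ∈ Finset.range r, (T ^ k) (T w - w) := by
        have := Finset.sum_range_sub (fun k => (T ^ k) w) r
        rw [pow_zero, Module.End.one_apply] at this
        rw [← this]
        refine Finset.sum_congr rfl fun k _ => ?_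
        rw [map_sub, pow_succ, Module.End.mul_apply]
      rw [hTr w hw, sub_self] at tel
      have h1 : ((p : ℤ) ^ s) • ((r : ℤ) • v + (p : ℤ) • ∑ k ∈ Finset.range r, g k) = 0 := by
        rw [tel]
        have : ∀ k ∈ Finset.range r, (T ^ k) (T w - w) = (p : ℤ) ^ s • (v + (p : ℤ) • g k) := by
          intro k _
          rw [h, map_smul, ← hg' k]; congr 1; abel
        rw [Finset.sum_congr rfl this, ← Finset.smul_sum, Finset.sum_add_distrib, ← Finset.smul_sum]
        simp
      have h2 := tf _ _ (pow_ne_zero s (by exact_mod_cast hp.ne_zero)) h1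
      have cop : IsCoprime (r : ℤ) (p : ℤ) := by
        rw [Nat.isCoprime_iff_coprime, Nat.coprime_comm]
        exact (Nat.Prime.coprime_iff_not_dvd hp).2 hr
      obtain ⟨x, y, hxy⟩ := cop
      refine ⟨y • v - x • ∑ k ∈ Finset.range r, g k,
        W.sub_mem (W.smul_mem _ hv) (W.smul_mem _ (W.sum_mem fun k _ => hg k)), ?_⟩
      have h3 : v = (p : ℤ) • (y • v - x • ∑ k ∈ Finset.range r, g k) := by
        have : (r : ℤ) • v = - ((p : ℤ) • ∑ k ∈ Finset.range r, g k) := eq_neg_of_add_eq_zero_left h2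
        calc v = (x * r + y * p) • v := by rw [hxy, one_smul]
          _ = x • ((r : ℤ) • v) + (p : ℤ) • (y • v) := by
            rw [add_smul, mul_smul, mul_comm y, mul_smul]
          _ = _ := by rw [this, smul_neg, smul_sub, smul_comm x]; abel
      rw [h, pow_succ, mul_smul, ← h3]
  intro w hw
  refine sub_eq_zero.1 (sep _ fun s => ?_)
  obtain ⟨v, -, h⟩ := key s w hw
  exact ⟨v, h⟩

/-- A periodic point of an endomorphism that is idempotent modulo `6` is fixed. -/
lemma eq_self_of_periodic {L : Submodule ℤ A} {B : Module.End ℤ A}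
    (tf : ∀ (n : ℤ) (a : A), n ≠ 0 → n • a = 0 → a = 0)
    (sep : ∀ p : ℕ, p.Prime → ∀ a : A, (∀ s : ℕ, ∃ b, a = ((p : ℤ) ^ s) • b) → a = 0)
    (hL : ∀ w ∈ L, B w ∈ L) (hB : ∀ w ∈ L, ∃ v ∈ L, B (B w) - B w = (6 : ℤ) • v)
    {q : ℕ} (hq : q ≠ 0) {u : A} (hu : u ∈ L) (hqu : (B ^ q) u = u) : B u = u := by
  let W : Submodule ℤ A := L ⊓ LinearMap.eqLocus (B ^ q) 1
  have hWq : ∀ w ∈ W, (B ^ q) w = w := fun w hw => hw.2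
  have hLk : ∀ k : ℕ, ∀ w ∈ L, (B ^ k) w ∈ L := by
    intro k
    induction k with
    | zero => simp
    | succ k ih =>
      intro w hw
      rw [pow_succ', Module.End.mul_apply]
      exact hL _ (ih w hw)
  have h6 : ∀ w ∈ W, ∃ v ∈ W, B w - w = (6 : ℤ) • v := by
    intro w hw
    obtain ⟨v, hv, h⟩ := hB w hw.1
    have hv' : B w - w = (6 : ℤ) • (B ^ (q - 1)) v := by
      have := congrArg (B ^ (q - 1)) h
      rw [map_smul, map_sub] at this
      rw [← this]
      have e : ∀ y, (B ^ (q - 1)) (B y) = (B ^ q) y := by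
        intro y
        rw [← Module.End.mul_apply, ← pow_succ, Nat.sub_add_cancel (Nat.pos_of_ne_zero hq)]
      rw [e, e, ← Module.End.mul_apply, ← pow_succ, pow_succ', Module.End.mul_apply, hWq w hw]
    refine ⟨_, ⟨hLk _ v hv, ?_⟩, hv'⟩
    refine sub_eq_zero.1 (tf 6 _ (by norm_num) ?_)
    rw [smul_sub, ← map_smul, ← hv', map_sub, hWq w hw, ← Module.End.mul_apply, ← pow_succ,
      pow_succ', Module.End.mul_apply, hWq w hw]
    change _ - ((6 : ℤ) • (B ^ (q - 1)) v) = 0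
    rw [← hv', sub_self]
  have h2 : ∀ w ∈ W, ∃ v ∈ W, B w - w = ((2 : ℕ) : ℤ) • v := fun w hw => by
    obtain ⟨v, hv, h⟩ := h6 w hw
    exact ⟨(3 : ℤ) • v, W.smul_mem _ hv, by rw [h, smul_smul]; norm_num⟩
  have h3 : ∀ w ∈ W, ∃ v ∈ W, B w - w = ((3 : ℕ) : ℤ) • v := fun w hw => by
    obtain ⟨v, hv, h⟩ := h6 w hw
    exact ⟨(2 : ℤ) • v, W.smul_mem _ hv, by rw [h, smul_smul]; norm_num⟩
  obtain ⟨e, q', hq', rfl⟩ := Nat.exists_eq_two_pow_mul_odd hq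
  have hT : ∀ w ∈ W, (B ^ 2 ^ e) w = w := by
    refine eq_self_of_pow_eq_self Nat.prime_two tf (sep 2 Nat.prime_two)
      (pow_sub_mem_smul h2 _) (r := q') hq'.not_two_dvd_nat ?_
    intro w hw
    rw [← pow_mul]
    exact hWq w hw
  refine eq_self_of_pow_eq_self Nat.prime_three tf (sep 3 Nat.prime_three) h3 (r := 2 ^ e) ?_ hT
    u ⟨hu, hqu⟩
  intro h
  have := Nat.prime_three.dvd_of_dvd_pow h
  omega

end Minkowski

section Filtration

variable {X : Type*} [DecidableEq X]

/-- Coefficients of iterated Fox derivatives. -/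
noncomputable def foxCoeff : List X → MonoidAlgebra ℤ (FreeGroup X) →ₗ[ℤ] ℤ
  | [] => (aug ℤ (FreeGroup X)).toLinearMap
  | j :: w => foxCoeff w ∘ₗ dfox j

/-- The powers of the augmentation ideal, described by iterated Fox derivatives. -/
noncomputable def augPow (X : Type*) [DecidableEq X] :
    ℕ → Submodule ℤ (MonoidAlgebra ℤ (FreeGroup X))
  | 0 => ⊤
  | c + 1 => LinearMap.ker (aug ℤ (FreeGroup X)).toLinearMap ⊓ ⨅ j, (augPow X c).comap (dfox j)

local notation "V" => augPow X

lemma mem_augPow_succ {c : ℕ} {a : MonoidAlgebra ℤ (FreeGroup X)} :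
    a ∈ V (c + 1) ↔ aug ℤ _ a = 0 ∧ ∀ j, dfox j a ∈ V c := by
  simp [augPow]

@[simp] lemma mem_augPow_zero (a : MonoidAlgebra ℤ (FreeGroup X)) : a ∈ V 0 := trivial

lemma mem_augPow_one {a : MonoidAlgebra ℤ (FreeGroup X)} : a ∈ V 1 ↔ aug ℤ _ a = 0 := by
  simp [mem_augPow_succ]

lemma mem_augPow_iff {c : ℕ} {a : MonoidAlgebra ℤ (FreeGroup X)} :
    a ∈ V c ↔ ∀ w : List X, w.length < c → foxCoeff w a = 0 := by
  induction c generalizing a with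
  | zero => simp
  | succ c ih =>
    rw [mem_augPow_succ]
    constructor
    · rintro ⟨h0, h⟩ w hw
      cases w with
      | nil => exact h0
      | cons j w => exact ih.1 (h j) w (by simpa using hw)
    · intro h
      exact ⟨h [] (by simp), fun j => ih.2 fun w hw => h (j :: w) (by simpa using hw)⟩

lemma augPow_succ_le (c : ℕ) : V (c + 1) ≤ V c := by
  intro a ha
  rw [mem_augPow_iff] at ha ⊢
  exact fun w hw => ha w (by omega)

lemma augPow_antitone : Antitone (augPow X) := antitone_nat_of_succ_le augPow_succ_le

lemma mul_mem_augPow_left {c : ℕ} (b : MonoidAlgebra ℤ (FreeGroup X)) {a} (ha : a ∈ V c) :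
    b * a ∈ V c := by
  induction c generalizing a with
  | zero => simp
  | succ c ih =>
    rw [mem_augPow_succ] at ha ⊢
    refine ⟨by simp [ha.1], fun j => ?_⟩
    rw [dfox_mul, ha.1, zero_smul, zero_add]
    exact ih (ha.2 j)

lemma mul_mem_augPow_right {c : ℕ} (b : MonoidAlgebra ℤ (FreeGroup X)) {a} (ha : a ∈ V c) :
    a * b ∈ V c := by
  induction c generalizing a b with
  | zero => simp
  | succ c ih =>
    have ha' := augPow_succ_le _ ha
    rw [mem_augPow_succ] at ha ⊢
    refine ⟨by simp [ha.1], fun j => ?_⟩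
    rw [dfox_mul]
    exact (V c).add_mem ((V c).smul_mem _ (ha.2 j)) (ih _ ha')

lemma mul_mem_augPow {s t : ℕ} {a b : MonoidAlgebra ℤ (FreeGroup X)} (ha : a ∈ V s)
    (hb : b ∈ V t) : a * b ∈ V (s + t) := by
  induction t generalizing b with
  | zero => exact mul_mem_augPow_right _ ha
  | succ t ih =>
    rw [← add_assoc]
    rw [mem_augPow_succ] at hb ⊢
    refine ⟨by simp [hb.1], fun j => ?_⟩
    rw [dfox_mul, hb.1, zero_smul, zero_add]
    exact ih (hb.2 j)

lemma gmap_mem_augPow [Fintype X] (ψ : FreeGroup X →* FreeGroup X) {c : ℕ}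
    {a : MonoidAlgebra ℤ (FreeGroup X)} (ha : a ∈ V c) : gmap ℤ ψ a ∈ V c := by
  induction c generalizing a with
  | zero => simp
  | succ c ih =>
    rw [mem_augPow_succ] at ha ⊢
    refine ⟨by simp [ha.1], fun j => ?_⟩
    rw [dfox_gmap]
    exact (V c).sum_mem fun l _ => mul_mem_augPow_right _ (ih (ha.2 l))

lemma mem_augPow_of_smul_mem {c : ℕ} {n : ℤ} (hn : n ≠ 0) {a : MonoidAlgebra ℤ (FreeGroup X)}
    (h : n • a ∈ V c) : a ∈ V c := by
  rw [mem_augPow_iff] at h ⊢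
  intro w hw
  have := h w hw
  rw [map_smul, smul_eq_mul] at this
  exact (mul_eq_zero.1 this).resolve_left hn

lemma mem_augPow_of_separated {c p : ℕ} (hp : p.Prime) {a : MonoidAlgebra ℤ (FreeGroup X)}
    (h : ∀ s : ℕ, ∃ b, a - ((p : ℤ) ^ s) • b ∈ V c) : a ∈ V c := by
  rw [mem_augPow_iff]
  intro w hw
  by_contra h0
  obtain ⟨b, hb⟩ := h (foxCoeff w a).natAbs
  rw [mem_augPow_iff] at hb
  have h1 := hb w hw
  rw [map_sub, map_smul, sub_eq_zero, smul_eq_mul] at h1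
  have h2 : ((p : ℤ) ^ (foxCoeff w a).natAbs) ∣ foxCoeff w a := ⟨_, h1⟩
  have h3 := Int.natAbs_dvd_natAbs.2 h2
  rw [Int.natAbs_pow, Int.natAbs_natCast] at h3
  have h4 := Nat.le_of_dvd (Int.natAbs_pos.2 h0) h3
  exact absurd h4 (not_le.2 (Nat.lt_pow_self hp.one_lt))

/-- An endomorphism that is idempotent modulo `6` on the abelianization is idempotent modulo `6`
on the associated graded ring. -/
lemma gmap_gmap_sub_mem [Fintype X] {ψ : FreeGroup X →* FreeGroup X}
    (h : ∀ j, ∃ u ∈ V 1, (single (ψ (ψ (.of j))) 1 - single (ψ (.of j)) 1 - (6 : ℤ) • u :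
      MonoidAlgebra ℤ (FreeGroup X)) ∈ V 2)
    (i : ℕ) {a : MonoidAlgebra ℤ (FreeGroup X)} (ha : a ∈ V i) :
    ∃ u ∈ V i, gmap ℤ ψ (gmap ℤ ψ a) - gmap ℤ ψ a - (6 : ℤ) • u ∈ V (i + 1) := by
  induction i generalizing a with
  | zero => exact ⟨0, by simp, by simp [mem_augPow_one]⟩
  | succ i ih =>
    choose u hu hu' using h
    rw [mem_augPow_succ] at ha
    choose v hv hv' using fun j => ih (ha.2 j)
    have e : a = ∑ j, dfox j a * (single (.of j) 1 - 1) := by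
      nth_rewrite 1 [dfox_fundamental a]
      rw [ha.1, map_zero, zero_add]
    set P := gmap ℤ ψ with hP
    set y : X → MonoidAlgebra ℤ (FreeGroup X) := fun j => single (.of j) 1 - 1 with hy
    have hy1 : ∀ j, y j ∈ V 1 := fun j => by simp [hy, mem_augPow_one]
    refine ⟨∑ j, (v j * P (P (y j)) + P (dfox j a) * u j), (V _).sum_mem fun j _ =>
      (V _).add_mem (mul_mem_augPow (hv j) (gmap_mem_augPow _ (gmap_mem_augPow _ (hy1 j))))
        (mul_mem_augPow (gmap_mem_augPow _ (ha.2 j)) (hu j)), ?_⟩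
    have e2 : P (P a) - P a - (6 : ℤ) • ∑ j, (v j * P (P (y j)) + P (dfox j a) * u j) =
        ∑ j, ((P (P (dfox j a)) - P (dfox j a) - (6 : ℤ) • v j) * P (P (y j)) +
          P (dfox j a) * (single (ψ (ψ (.of j))) 1 - single (ψ (.of j)) 1 - (6 : ℤ) • u j)) := by
      have e5 : P a = ∑ j, P (dfox j a) * P (y j) := by
        conv_lhs => rw [e]
        simp only [map_sum, map_mul, hy]
      rw [e5]
      simp only [map_sum, map_mul, Finset.smul_sum, ← Finset.sum_sub_distrib]
      refine Finset.sum_congr rfl fun j _ => ?_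
      have e3 : P (y j) = single (ψ (.of j)) 1 - 1 := by simp [hP, hy]
      have e4 : P (single (ψ (.of j)) 1 - 1) = single (ψ (ψ (.of j))) 1 - 1 := by simp [hP]
      rw [e3, e4]
      simp only [sub_mul, mul_sub, smul_add, smul_mul_assoc, mul_smul_comm, mul_one]
      abel
    rw [e2]
    refine (V _).sum_mem fun j _ => (V _).add_mem ?_ ?_
    · exact mul_mem_augPow (hv' j) (gmap_mem_augPow _ (gmap_mem_augPow _ (hy1 j)))
    · exact mul_mem_augPow (s := i) (t := 2) (gmap_mem_augPow _ (ha.2 j)) (hu' j)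

end Filtration

section Residual

open scoped Pointwise

variable {Z : Type} [DecidableEq Z]

/-- Prepend the letter `j`, killing the words that already start with `j`. -/
noncomputable def prependOp (j : Z) : Module.End ℤ (List Z →₀ ℤ) :=
  Finsupp.linearCombination ℤ fun w => if w.head? = some j then 0 else Finsupp.single (j :: w) 1

lemma prependOp_single (j : Z) (w : List Z) (r : ℤ) : prependOp j (.single w r) =
    if w.head? = some j then 0 else Finsupp.single (j :: w) r := by
  simp [prependOp]

lemma prependOp_sq (j : Z) : prependOp j * prependOp j = 0 := by
  ext w : 2
  simp only [LinearMap.comp_apply, Finsupp.lsingle_apply, Module.End.mul_apply, prependOp_single]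
  split_ifs
  · simp
  · simp [prependOp_single]

lemma prependOp_apply_nil (j : Z) (v : List Z →₀ ℤ) : prependOp j v [] = 0 := by
  induction v using Finsupp.induction_linear with
  | zero => simp
  | add a b ha hb => simp [ha, hb]
  | single w r => rw [prependOp_single]; split_ifs <;> simp

lemma prependOp_apply_cons (j l : Z) (w : List Z) (v : List Z →₀ ℤ) : prependOp j v (l :: w) =
    if l = j ∧ w.head? ≠ some j then v w else 0 := by
  induction v using Finsupp.induction_linear with
  | zero => simp
  | add a b ha hb => simp only [map_add, Finsupp.add_apply, ha, hb]; split_ifs <;> simp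
  | single w' r =>
    rw [prependOp_single]
    simp only [ne_eq]
    split_ifs with h1 h2 h2
    · simp only [Finsupp.coe_zero, Pi.zero_apply]
      rw [Finsupp.single_apply, if_neg]
      rintro rfl
      exact h2.2 h1
    · simp
    · simp [Finsupp.single_apply, h2.1]
    · rw [Finsupp.single_apply, if_neg]
      intro h
      injection h with h h'
      subst h h'
      exact h2 ⟨rfl, h1⟩

/-- The unipotent operator attached to a letter. -/
noncomputable def letterUnit (j : Z) : (Module.End ℤ (List Z →₀ ℤ))ˣ where
  val := 1 + prependOp j
  inv := 1 - prependOp j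
  val_inv := by simp [add_mul, mul_sub, prependOp_sq]
  inv_val := by simp [sub_mul, mul_add, prependOp_sq]

lemma letterUnit_zpow (j : Z) (e : ℤ) :
    ((letterUnit j ^ e : (Module.End ℤ (List Z →₀ ℤ))ˣ) : Module.End ℤ (List Z →₀ ℤ)) =
      1 + e • prependOp j := by
  induction e with
  | zero => simp
  | succ n ih =>
    rw [zpow_add_one, Units.val_mul, ih]
    simp only [letterUnit, add_mul, mul_add, smul_mul_assoc, prependOp_sq, add_smul]
    simp [add_assoc, add_comm]
  | pred n ih =>
    rw [zpow_sub_one, Units.val_mul, ih]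
    simp only [letterUnit, Units.inv_mk, add_mul, mul_sub, smul_mul_assoc, prependOp_sq, sub_smul]
    simp [add_assoc, sub_eq_add_neg]

/-- The vectors all of whose longest words start with `j`. -/
def topHead (j : Z) : Set (List Z →₀ ℤ) :=
  {v | ∃ d, (∀ w, d < w.length → v w = 0) ∧ (∀ w, w.length = d → v w ≠ 0 → w.head? = some j) ∧
    ∃ w, w.length = d ∧ v w ≠ 0}

/-- The unipotent representation of a free group on words. -/
noncomputable def wordRep (Z : Type) [DecidableEq Z] :
    FreeGroup Z →* (Module.End ℤ (List Z →₀ ℤ))ˣ :=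
  FreeGroup.lift letterUnit

lemma wordRep_injective [Nontrivial Z] : Function.Injective (wordRep Z) := by
  have h0 : wordRep Z = (Monoid.CoprodI.lift fun i => FreeGroup.lift fun _ => letterUnit i).comp
      (@freeGroupEquivCoprodI Z).toMonoidHom := by
    ext i
    simp [wordRep]
  rw [h0, MonoidHom.coe_comp]
  refine Function.Injective.comp ?_ (MulEquiv.injective freeGroupEquivCoprodI)
  let f : ∀ i : Z, FreeGroup Unit →* (Module.End ℤ (List Z →₀ ℤ))ˣ :=
    fun i => FreeGroup.lift fun _ => letterUnit i
  refine Monoid.CoprodI.lift_injective_of_ping_pong f ?_ topHead ?_ ?_ ?_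
  · refine Or.inr ⟨Classical.arbitrary Z, ?_⟩
    rw [FreeGroup.freeGroupUnitEquivInt.cardinal_eq, Cardinal.mk_denumerable]
    exact (Cardinal.natCast_lt_aleph0 (n := 3)).le
  · intro j
    refine ⟨Finsupp.single [j] 1, 1, ?_, ?_, [j], rfl, by simp⟩
    · intro w hw
      rw [Finsupp.single_apply, if_neg]
      rintro rfl
      simp at hw
    · intro w _ hw
      rw [Finsupp.single_apply] at hw
      split_ifs at hw with h
      · simp [← h]
      · exact absurd rfl hw
  · intro i j hij
    rw [Function.onFun, Set.disjoint_left]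
    rintro v ⟨d, h1, h2, w, hw, hw'⟩ ⟨d', h1', h2', w', hw1, hw1'⟩
    have : d = d' := by
      rcases lt_trichotomy d d' with h | h | h
      · exact absurd (h1 w' (by omega)) hw1'
      · exact h
      · exact absurd (h1' w (by omega)) hw'
    subst this
    have := (h2 w hw hw').symm.trans (h2' w hw hw')
    exact hij (Option.some_injective _ this)
  · intro i j hij
    refine FreeGroup.freeGroupUnitEquivInt.forall_congr_left.mpr ?_
    intro e he
    have he0 : e ≠ 0 := by
      rintro rfl
      exact he (by simp [FreeGroup.freeGroupUnitEquivInt])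
    change FreeGroup.lift (fun _ => letterUnit i) (FreeGroup.of () ^ e) • topHead j ⊆ topHead i
    simp only [map_zpow, FreeGroup.lift_apply_of]
    rintro _ ⟨v, ⟨d, h1, h2, w, hw, hw'⟩, rfl⟩
    have hval : ∀ w, ((letterUnit i ^ e) • v) w = v w + e * prependOp i v w := by
      intro w
      rw [Units.smul_def, letterUnit_zpow]
      simp
    have hw0 : w.head? ≠ some i := by
      rw [h2 w hw hw']
      exact fun h => hij (Option.some_injective _ h).symm
    change (letterUnit i ^ e) • v ∈ _
    refine ⟨d + 1, ?_, ?_, i :: w, by simp [hw], ?_⟩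
    · intro w hw
      rw [hval, h1 w (by omega)]
      cases w with
      | nil => simp at hw
      | cons l w =>
        rw [prependOp_apply_cons, h1 w (by simpa using hw)]
        simp
    · intro w hw hw'
      rw [hval, h1 w (by omega)] at hw'
      cases w with
      | nil => simp at hw
      | cons l w =>
        rw [prependOp_apply_cons] at hw'
        split_ifs at hw' with h
        · simp [h.1]
        · simp at hw'
    · rw [hval, h1 _ (by simp [hw]), prependOp_apply_cons, if_pos ⟨rfl, hw0⟩]
      simpa using ⟨he0, hw'⟩

/-- Vectors supported on words of length at least `s`. -/
def lengthGE (Z : Type) (s : ℕ) : Submodule ℤ (List Z →₀ ℤ) where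
  carrier := {v | ∀ w : List Z, w.length < s → v w = 0}
  add_mem' ha hb w hw := by simp [ha w hw, hb w hw]
  zero_mem' := by simp
  smul_mem' r v hv w hw := by simp [hv w hw]

lemma prependOp_mem (j : Z) {s : ℕ} {v : List Z →₀ ℤ} (hv : v ∈ lengthGE Z s) :
    prependOp j v ∈ lengthGE Z (s + 1) := by
  intro w hw
  cases w with
  | nil => exact prependOp_apply_nil j v
  | cons l w =>
    rw [prependOp_apply_cons, hv w (by simpa using hw)]
    simp

lemma lengthGE_succ_le {Y : Type} (s : ℕ) : lengthGE Y (s + 1) ≤ lengthGE Y s :=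
  fun _ hv w hw => hv w (by omega)

lemma wordRep_mem (f : FreeGroup Z) {s : ℕ} {v : List Z →₀ ℤ} (hv : v ∈ lengthGE Z s) :
    (wordRep Z f).val v ∈ lengthGE Z s := by
  induction f using FreeGroup.induction_on generalizing v with
  | C1 => simpa using hv
  | of x =>
    simp only [wordRep, FreeGroup.lift_apply_of, letterUnit]
    exact add_mem hv (lengthGE_succ_le _ (prependOp_mem x hv))
  | inv_of x _ =>
    simp only [wordRep, map_inv, FreeGroup.lift_apply_of, letterUnit, Units.inv_mk]
    exact sub_mem hv (lengthGE_succ_le _ (prependOp_mem x hv))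
  | mul f g hf hg =>
    rw [map_mul, Units.val_mul, Module.End.mul_apply]
    exact hf (hg hv)

variable {X : Type} [DecidableEq X] [Fintype X]

/-- An element of a free group that is trivial to all orders is trivial. -/
theorem eq_one_of_forall_mem_augPow {f : FreeGroup X}
    (h : ∀ c, (single f 1 - 1 : MonoidAlgebra ℤ (FreeGroup X)) ∈ augPow X c) : f = 1 := by
  let i : FreeGroup X →* FreeGroup (X ⊕ Bool) := FreeGroup.map Sum.inl
  have hi : Function.Injective i := FreeGroup.map_injective Sum.inl_injective
  let ρ : MonoidAlgebra ℤ (FreeGroup X) →ₐ[ℤ] Module.End ℤ (List (X ⊕ Bool) →₀ ℤ) :=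
    MonoidAlgebra.lift ℤ _ _ ((Units.coeHom _).comp ((wordRep (X ⊕ Bool)).comp i))
  have hρ : ∀ g, ρ (single g 1) = (wordRep (X ⊕ Bool) (i g)).val := fun g => by simp [ρ]
  have key : ∀ c a, a ∈ augPow X c → ∀ s, ∀ v ∈ lengthGE (X ⊕ Bool) s,
      ρ a v ∈ lengthGE (X ⊕ Bool) (s + c) := by
    intro c
    induction c with
    | zero =>
      intro a _ s v hv
      induction a using MonoidAlgebra.induction_linear with
      | zero => simp
      | add a b ha hb =>
        rw [map_add, LinearMap.add_apply]
        exact add_mem (ha trivial) (hb trivial)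
      | single g r =>
        have : (single g r : MonoidAlgebra ℤ (FreeGroup X)) = r • single g 1 := by simp
        rw [this, map_smul, hρ]
        exact Submodule.smul_mem _ _ (wordRep_mem _ hv)
    | succ c ih =>
      intro a ha s v hv
      rw [mem_augPow_succ] at ha
      rw [dfox_fundamental a, ha.1, map_zero, zero_add, map_sum, LinearMap.sum_apply]
      refine sum_mem fun j _ => ?_
      rw [map_mul, Module.End.mul_apply, add_comm c, ← add_assoc]
      refine ih _ (ha.2 j) _ _ ?_
      have : ρ (single (FreeGroup.of j) 1 - 1) = prependOp (.inl j) := by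
        rw [map_sub, hρ, map_one]
        simp [i, wordRep, letterUnit]
      rw [this]
      exact prependOp_mem _ hv
  have h1 : wordRep (X ⊕ Bool) (i f) = 1 := by
    refine Units.ext (LinearMap.ext fun v => Finsupp.ext fun w => ?_)
    have := key _ _ (h (w.length + 1)) 0 v (fun w hw => by simp at hw) w (by omega)
    rw [map_sub, hρ, map_one] at this
    simpa [sub_eq_zero] using this
  have : Nontrivial (X ⊕ Bool) := ⟨.inr true, .inr false, by simp⟩
  have h2 : i f = 1 := wordRep_injective (h1.trans (map_one _).symm)
  exact hi (h2.trans (map_one _).symm)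

end Residual

section Growth

/-- A sequence of polynomial growth does not grow by a fixed factor in steps of fixed length. -/
lemma exists_slow_step {a : ℕ → ℕ} (ha : ∀ r, 0 < a r) {c W : ℕ}
    (hb : ∀ r, 1 ≤ r → a r ≤ (2 * r ^ c + 1) ^ W) {n m : ℕ} (hnm : n < m) (s : ℕ) :
    ∃ r, n * a (r + s) < m * a r := by
  by_contra! hcon
  rcases Nat.eq_zero_or_pos n with rfl | hn
  · have := hcon 0
    have := ha 0
    nlinarith [ha 0]
  rcases Nat.eq_zero_or_pos s with rfl | hs
  · have := hcon 0
    have := ha 0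
    simp only [add_zero] at *
    nlinarith
  have h1 : ∀ t, m ^ t * a 0 ≤ n ^ t * a (t * s) := by
    intro t
    induction t with
    | zero => simp
    | succ t ih =>
      have := hcon (t * s)
      calc m ^ (t + 1) * a 0 = m * (m ^ t * a 0) := by ring
        _ ≤ m * (n ^ t * a (t * s)) := Nat.mul_le_mul_left _ ih
        _ = n ^ t * (m * a (t * s)) := by ring
        _ ≤ n ^ t * (n * a (t * s + s)) := Nat.mul_le_mul_left _ this
        _ = n ^ (t + 1) * a ((t + 1) * s) := by rw [add_mul, one_mul]; ring
  have h2 : ∀ t, 1 ≤ t → m ^ t ≤ n ^ t * ((3 * s ^ c) ^ W * t ^ (c * W)) := by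
    intro t ht
    calc m ^ t ≤ m ^ t * a 0 := Nat.le_mul_of_pos_right _ (ha 0)
      _ ≤ n ^ t * a (t * s) := h1 t
      _ ≤ n ^ t * (2 * (t * s) ^ c + 1) ^ W :=
        Nat.mul_le_mul_left _ (hb _ (Nat.mul_pos ht hs))
      _ ≤ n ^ t * (3 * (t * s) ^ c) ^ W := by
        refine Nat.mul_le_mul_left _ (Nat.pow_le_pow_left ?_ _)
        have : 0 < (t * s) ^ c := pow_pos (Nat.mul_pos ht hs) _
        omega
      _ = _ := by rw [pow_mul, ← mul_pow]; congr 2; ring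
  have hρ : (1 : ℝ) < (m : ℝ) / n := by
    rw [one_lt_div (by exact_mod_cast hn)]
    exact_mod_cast hnm
  have lim := tendsto_pow_const_div_const_pow_of_one_lt (c * W) hρ
  set C : ℝ := (((3 * s ^ c) ^ W : ℕ) : ℝ) with hC
  have hCpos : 0 < C := by
    rw [hC]
    exact_mod_cast pow_pos (Nat.mul_pos (by norm_num) (pow_pos hs _)) _
  have hlt := lim.eventually_lt_const (u := 1 / C) (by positivity)
  obtain ⟨t, h3, ht⟩ := (hlt.and (Filter.eventually_ge_atTop 1)).exists
  have h4 : (m : ℝ) ^ t ≤ (n : ℝ) ^ t * (C * (t : ℝ) ^ (c * W)) := by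
    rw [hC]
    exact_mod_cast h2 t ht
  have hn' : (0 : ℝ) < (n : ℝ) ^ t := by positivity
  have hm' : (0 : ℝ) < (m : ℝ) ^ t := by
    have : 0 < m := by omega
    positivity
  rw [div_pow, div_div_eq_mul_div, div_lt_div_iff₀ hm' hCpos] at h3
  nlinarith

end Growth

section NilpotentQuotient

variable {X : Type} [DecidableEq X]

local notation "V" => augPow X

/-- Coefficients of group elements. -/
noncomputable def grpCoeff (w : List X) (f : FreeGroup X) : ℤ := foxCoeff w (single f 1)

/-- The dimension subgroups of a free group. -/
def dimSubgroup (X : Type) [DecidableEq X] (c : ℕ) : Subgroup (FreeGroup X) where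
  carrier := {f | (single f 1 - 1 : MonoidAlgebra ℤ (FreeGroup X)) ∈ augPow X c}
  one_mem' := by simp [← one_def]
  mul_mem' {f g} hf hg := by
    have : (single (f * g) 1 - 1 : MonoidAlgebra ℤ (FreeGroup X)) =
        (single f 1 - 1) * single g 1 + (single g 1 - 1) := by
      simp [sub_mul, single_mul_single]
    rw [Set.mem_ofPred_eq, this]
    exact add_mem (mul_mem_augPow_right _ hf) hg
  inv_mem' {f} hf := by
    have : (single f⁻¹ 1 - 1 : MonoidAlgebra ℤ (FreeGroup X)) =
        -(single f⁻¹ 1 * (single f 1 - 1)) := by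
      simp [mul_sub, single_mul_single, one_def]
    rw [Set.mem_ofPred_eq, this]
    exact neg_mem (mul_mem_augPow_left _ hf)

lemma mem_dimSubgroup {c : ℕ} {f : FreeGroup X} :
    f ∈ dimSubgroup X c ↔ (single f 1 - 1 : MonoidAlgebra ℤ (FreeGroup X)) ∈ V c := Iff.rfl

lemma inv_mul_mem_dimSubgroup {c : ℕ} {f g : FreeGroup X} : f⁻¹ * g ∈ dimSubgroup X c ↔
    (single g 1 - single f 1 : MonoidAlgebra ℤ (FreeGroup X)) ∈ V c := by
  have h1 : (single (f⁻¹ * g) 1 - 1 : MonoidAlgebra ℤ (FreeGroup X)) =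
      single f⁻¹ 1 * (single g 1 - single f 1) := by
    simp [mul_sub, single_mul_single, one_def]
  have h2 : (single g 1 - single f 1 : MonoidAlgebra ℤ (FreeGroup X)) =
      single f 1 * (single (f⁻¹ * g) 1 - 1) := by
    simp [mul_sub, single_mul_single]
  rw [mem_dimSubgroup]
  constructor
  · intro h
    rw [h2]
    exact mul_mem_augPow_left _ h
  · intro h
    rw [h1]
    exact mul_mem_augPow_left _ h

instance (c : ℕ) : (dimSubgroup X c).Normal where
  conj_mem f hf g := by
    rw [mem_dimSubgroup] at hf ⊢
    have : (single (g * f * g⁻¹) 1 - 1 : MonoidAlgebra ℤ (FreeGroup X)) =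
        single g 1 * (single f 1 - 1) * single g⁻¹ 1 := by
      simp [mul_sub, sub_mul, single_mul_single, one_def]
    rw [this]
    exact mul_mem_augPow_right _ (mul_mem_augPow_left _ hf)

/-- The torsion-free nilpotent quotients of a free group. -/
def NilQuot (X : Type) [DecidableEq X] (c : ℕ) : Type := FreeGroup X ⧸ dimSubgroup X c

instance (c : ℕ) : Group (NilQuot X c) :=
  inferInstanceAs (Group (FreeGroup X ⧸ dimSubgroup X c))

/-- The projection to the nilpotent quotient. -/
def toNil (c : ℕ) : FreeGroup X →* NilQuot X c := QuotientGroup.mk' _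

lemma toNil_surjective (c : ℕ) : Function.Surjective (toNil (X := X) c) :=
  QuotientGroup.mk'_surjective _

lemma toNil_eq_iff {c : ℕ} {f g : FreeGroup X} : toNil c f = toNil c g ↔
    (single g 1 - single f 1 : MonoidAlgebra ℤ (FreeGroup X)) ∈ V c := by
  rw [← inv_mul_mem_dimSubgroup]
  exact QuotientGroup.eq

lemma toNil_eq_iff_grpCoeff {c : ℕ} {f g : FreeGroup X} : toNil c f = toNil c g ↔
    ∀ w : List X, w.length < c → grpCoeff w f = grpCoeff w g := by
  rw [toNil_eq_iff, mem_augPow_iff]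
  simp only [map_sub, sub_eq_zero, grpCoeff]
  exact forall₂_congr fun _ _ => eq_comm

section Order

variable [Encodable X]

/-- The coefficients of an element of the nilpotent quotient, listed by increasing degree. -/
noncomputable def nilKey (c : ℕ) (x : NilQuot X c) : Lex (ℕ ×ₗ ℕ → ℤ) :=
  toLex fun p => match (Encodable.decode (ofLex p).2 : Option (List X)) with
    | some w => if w.length = (ofLex p).1 ∧ w.length < c
        then grpCoeff w (Function.surjInv (toNil_surjective c) x) else 0
    | none => 0

lemma nilKey_toNil (c : ℕ) (f : FreeGroup X) (p : ℕ ×ₗ ℕ) : ofLex (nilKey c (toNil c f)) p =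
    match (Encodable.decode (ofLex p).2 : Option (List X)) with
    | some w => if w.length = (ofLex p).1 ∧ w.length < c then grpCoeff w f else 0
    | none => 0 := by
  simp only [nilKey, ofLex_toLex]
  cases (Encodable.decode (ofLex p).2 : Option (List X)) with
  | none => rfl
  | some w =>
    dsimp only
    split_ifs with h
    · exact toNil_eq_iff_grpCoeff.1 (Function.surjInv_eq (toNil_surjective c) (toNil c f)) w h.2
    · rfl

lemma nilKey_encode {c : ℕ} (f : FreeGroup X) {w : List X} (hw : w.length < c) :
    ofLex (nilKey c (toNil c f)) (toLex (w.length, Encodable.encode w)) = grpCoeff w f := by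
  rw [nilKey_toNil]
  simp [hw]

lemma nilKey_injective (c : ℕ) : Function.Injective (nilKey (X := X) c) := by
  intro x y h
  obtain ⟨f, rfl⟩ := toNil_surjective c x
  obtain ⟨g, rfl⟩ := toNil_surjective c y
  rw [toNil_eq_iff_grpCoeff]
  intro w hw
  rw [← nilKey_encode f hw, ← nilKey_encode g hw, h]

noncomputable instance (c : ℕ) : LinearOrder (NilQuot X c) :=
  LinearOrder.lift' (nilKey c) (nilKey_injective c)

lemma nilQuot_lt_iff {c : ℕ} {x y : NilQuot X c} : x < y ↔
    ∃ p, (∀ p' < p, ofLex (nilKey c x) p' = ofLex (nilKey c y) p') ∧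
      ofLex (nilKey c x) p < ofLex (nilKey c y) p := Iff.rfl

/-- The order only depends on the difference to leading order. -/
lemma nilQuot_lt_of_lt {c : ℕ} {f g f' g' : FreeGroup X}
    (h : ∀ d, (single g 1 - single f 1 : MonoidAlgebra ℤ (FreeGroup X)) ∈ V d →
      ((single g' 1 - single f' 1) - (single g 1 - single f 1) :
        MonoidAlgebra ℤ (FreeGroup X)) ∈ V (d + 1))
    (hlt : toNil c f < toNil c g) : toNil c f' < toNil c g' := by
  obtain ⟨p, h1, h2⟩ := nilQuot_lt_iff.1 hlt
  have hpc : (ofLex p).1 < c := by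
    by_contra hc
    rw [nilKey_toNil, nilKey_toNil] at h2
    cases hd : (Encodable.decode (ofLex p).2 : Option (List X)) with
    | none => simp [hd] at h2
    | some w =>
      simp only [hd] at h2
      rw [if_neg (by omega), if_neg (by omega)] at h2
      exact lt_irrefl _ h2
  have h3 := h (ofLex p).1 (mem_augPow_iff.2 fun w hw => by
    have := h1 (toLex (w.length, Encodable.encode w)) (Prod.Lex.toLex_lt_toLex.2 (Or.inl hw))
    rw [nilKey_encode _ (hw.trans hpc), nilKey_encode _ (hw.trans hpc)] at this
    rw [map_sub, sub_eq_zero]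
    exact this.symm)
  rw [mem_augPow_iff] at h3
  have h4 : ∀ p', p' ≤ p → ofLex (nilKey c (toNil c g')) p' - ofLex (nilKey c (toNil c f')) p' =
      ofLex (nilKey c (toNil c g)) p' - ofLex (nilKey c (toNil c f)) p' := by
    intro p' hp'
    have hle : (ofLex p').1 ≤ (ofLex p).1 := by
      rcases Prod.Lex.le_iff.1 hp' with h | h
      · exact h.le
      · exact h.1.le
    simp only [nilKey_toNil]
    cases (Encodable.decode (ofLex p').2 : Option (List X)) with
    | none => rfl
    | some w =>
      dsimp only
      split_ifs with hw
      · have := h3 w (by omega)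
        simp only [map_sub] at this
        simp only [grpCoeff]
        linarith
      · rfl
  refine nilQuot_lt_iff.2 ⟨p, fun p' hp' => ?_, ?_⟩
  · have := h4 p' hp'.le
    rw [h1 p' hp', sub_self, sub_eq_zero] at this
    exact this.symm
  · have := h4 p le_rfl
    linarith

instance (c : ℕ) : MulLeftStrictMono (NilQuot X c) where
  elim z x y hxy := by
    obtain ⟨f, rfl⟩ := toNil_surjective c x
    obtain ⟨g, rfl⟩ := toNil_surjective c y
    obtain ⟨h, rfl⟩ := toNil_surjective c z
    simp only [← map_mul]
    refine nilQuot_lt_of_lt (fun d hd => ?_) hxy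
    have : (single (h * g) 1 - single (h * f) 1 - (single g 1 - single f 1) :
        MonoidAlgebra ℤ (FreeGroup X)) = (single h 1 - 1) * (single g 1 - single f 1) := by
      simp [mul_sub, sub_mul, single_mul_single]
      abel
    rw [this, add_comm]
    exact mul_mem_augPow (by simp [mem_augPow_one]) hd

instance (c : ℕ) : MulRightStrictMono (NilQuot X c) where
  elim z x y hxy := by
    obtain ⟨f, rfl⟩ := toNil_surjective c x
    obtain ⟨g, rfl⟩ := toNil_surjective c y
    obtain ⟨h, rfl⟩ := toNil_surjective c z
    simp only [Function.swap, ← map_mul]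
    refine nilQuot_lt_of_lt (fun d hd => ?_) hxy
    have : (single (g * h) 1 - single (f * h) 1 - (single g 1 - single f 1) :
        MonoidAlgebra ℤ (FreeGroup X)) = (single g 1 - single f 1) * (single h 1 - 1) := by
      simp [mul_sub, sub_mul, single_mul_single]
    rw [this]
    exact mul_mem_augPow hd (by simp [mem_augPow_one])

end Order

section Ball

variable [Fintype X]

open scoped Pointwise

/-- The ball of radius one. -/
def unitBall (X : Type) [DecidableEq X] [Fintype X] : Finset (FreeGroup X) :=
  insert 1 (Finset.univ.image FreeGroup.of ∪ Finset.univ.image fun x => (FreeGroup.of x)⁻¹)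

lemma one_mem_unitBall : (1 : FreeGroup X) ∈ unitBall X := by simp [unitBall]

lemma exists_mem_unitBall_pow (f : FreeGroup X) : ∃ r, f ∈ unitBall X ^ r := by
  induction f using FreeGroup.induction_on with
  | C1 => exact ⟨0, by simp⟩
  | of x => exact ⟨1, by simp [unitBall]⟩
  | inv_of x _ => exact ⟨1, by simp [unitBall]⟩
  | mul f g hf hg =>
    obtain ⟨r, hr⟩ := hf
    obtain ⟨s, hs⟩ := hg
    exact ⟨r + s, by rw [pow_add]; exact Finset.mul_mem_mul hr hs⟩

lemma grpCoeff_le {r : ℕ} {f : FreeGroup X} (hf : f ∈ unitBall X ^ r) (w : List X) :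
    |grpCoeff w f| ≤ (r : ℤ) ^ w.length := by
  induction w generalizing r f with
  | nil => simp [grpCoeff, foxCoeff]
  | cons j w ihw =>
    induction r generalizing f with
    | zero =>
      rw [pow_zero, Finset.mem_one] at hf
      simp [hf, grpCoeff, foxCoeff]
    | succ r ihr =>
      have hf' := hf
      rw [pow_succ, Finset.mem_mul] at hf
      obtain ⟨g, hg, y, hy, rfl⟩ := hf
      have e : grpCoeff (j :: w) (g * y) =
          grpCoeff (j :: w) g + foxCoeff w (single g 1 * fox ℤ j y) := by
        simp [grpCoeff, foxCoeff, fox_mul]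
      have b : |foxCoeff w (single g 1 * fox ℤ j y)| ≤ ((r + 1 : ℕ) : ℤ) ^ w.length := by
        have pos : (0 : ℤ) ≤ ((r + 1 : ℕ) : ℤ) ^ w.length := by positivity
        simp only [unitBall, Finset.mem_insert, Finset.mem_union, Finset.mem_image,
          Finset.mem_univ, true_and] at hy
        rcases hy with rfl | ⟨x, rfl⟩ | ⟨x, rfl⟩
        · simpa using pos
        · rw [fox_of]
          split_ifs
          · rw [mul_one]
            refine (ihw hg).trans ?_
            gcongr
            simp
          · simpa using pos
        · have : fox ℤ j (FreeGroup.of x)⁻¹ = -(single (FreeGroup.of x)⁻¹ 1 * fox ℤ j (.of x)) :=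
            crossed_inv ..
          rw [this, fox_of]
          split_ifs
          · rw [mul_one, mul_neg, single_mul_single, map_neg, abs_neg, one_mul]
            exact ihw hf'
          · simpa using pos
      rw [e, List.length_cons]
      refine (abs_add_le _ _).trans ((add_le_add (ihr hg) b).trans ?_)
      rw [List.length_cons, pow_succ, pow_succ]
      push_cast
      have : (r : ℤ) ^ w.length ≤ ((r : ℤ) + 1) ^ w.length := by gcongr; simp
      nlinarith

lemma card_image_toNil_le (c : ℕ) [DecidableEq (NilQuot X c)] :
    ∃ W, ∀ r, 1 ≤ r → ((unitBall X ^ r).image (toNil c)).card ≤ (2 * r ^ c + 1) ^ W := by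
  have fin : Finite {w : List X // w.length < c} := (List.finite_length_lt X c).to_subtype
  have := Fintype.ofFinite {w : List X // w.length < c}
  refine ⟨Fintype.card {w : List X // w.length < c}, fun r hr => ?_⟩
  let g : NilQuot X c → {w : List X // w.length < c} → ℤ := fun x w =>
    grpCoeff w.1 (Function.surjInv (toNil_surjective c) x)
  have hg : ∀ f w, g (toNil c f) w = grpCoeff w.1 f := fun f w =>
    toNil_eq_iff_grpCoeff.1 (Function.surjInv_eq (toNil_surjective c) (toNil c f)) w.1 w.2
  have hinj : Function.Injective g := by
    intro x y h
    obtain ⟨f, rfl⟩ := toNil_surjective c x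
    obtain ⟨f', rfl⟩ := toNil_surjective c y
    rw [toNil_eq_iff_grpCoeff]
    intro w hw
    rw [← hg f ⟨w, hw⟩, ← hg f' ⟨w, hw⟩, h]
  have := Finset.card_le_card_of_injOn (s := (unitBall X ^ r).image (toNil c))
    (t := Fintype.piFinset fun _ => Finset.Icc (-((r : ℤ) ^ c)) ((r : ℤ) ^ c)) g ?_ hinj.injOn
  · refine this.trans (le_of_eq ?_)
    rw [Fintype.card_piFinset, Finset.prod_const, Int.card_Icc, Finset.card_univ]
    congr 1
    have : ((r : ℤ) ^ c + 1 - -((r : ℤ) ^ c)) = ((2 * r ^ c + 1 : ℕ) : ℤ) := by push_cast; ring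
    rw [this, Int.toNat_natCast]
  · intro x hx
    simp only [Finset.coe_image, Set.mem_image, Finset.mem_coe] at hx
    obtain ⟨f, hf, rfl⟩ := hx
    simp only [Finset.mem_coe, Fintype.mem_piFinset, Finset.mem_Icc, ← abs_le]
    intro w
    rw [hg]
    refine (grpCoeff_le hf w.1).trans ?_
    exact pow_le_pow_right₀ (by exact_mod_cast hr) w.2.le

end Ball

end NilpotentQuotient

section EndPow

variable {G : Type*} [Group G]

/-- Powers of an endomorphism. -/
def endPow (ψ : G →* G) : ℕ → (G →* G)
  | 0 => MonoidHom.id G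
  | i + 1 => (endPow ψ i).comp ψ

@[simp] lemma endPow_zero (ψ : G →* G) (x : G) : endPow ψ 0 x = x := rfl

lemma endPow_succ (ψ : G →* G) (i : ℕ) (x : G) : endPow ψ (i + 1) x = endPow ψ i (ψ x) := rfl

lemma endPow_succ_apply (ψ : G →* G) (i : ℕ) (x : G) : endPow ψ (i + 1) x = ψ (endPow ψ i x) := by
  induction i generalizing x with
  | zero => rfl
  | succ i ih => rw [endPow_succ, ih, endPow_succ]

lemma endPow_add (ψ : G →* G) (i j : ℕ) (x : G) :
    endPow ψ (i + j) x = endPow ψ i (endPow ψ j x) := by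
  induction j generalizing x with
  | zero => rfl
  | succ j ih => rw [← add_assoc, endPow_succ, ih, endPow_succ]

lemma endPow_mul (ψ : G →* G) (i j : ℕ) (x : G) :
    endPow ψ (i * j) x = endPow (endPow ψ i) j x := by
  induction j generalizing x with
  | zero => rfl
  | succ j ih => rw [mul_add, mul_one, endPow_add, ih, endPow_succ]

end EndPow

section NilEndo

variable {X : Type} [DecidableEq X] [Fintype X]

lemma gmap_pow (ψ : FreeGroup X →* FreeGroup X) (i : ℕ) (a : MonoidAlgebra ℤ (FreeGroup X)) :
    ((gmap ℤ ψ).toLinearMap ^ i) a = gmap ℤ (endPow ψ i) a := by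
  induction i generalizing a with
  | zero =>
    induction a using MonoidAlgebra.induction_linear with
    | zero => simp
    | add a b h h' => simp only [map_add, h, h']
    | single f r => simp
  | succ i ih =>
    rw [pow_succ, Module.End.mul_apply, ih, AlgHom.toLinearMap_apply, gmap_gmap]
    rfl

/-- The endomorphism of the nilpotent quotient induced by an endomorphism of the free group. -/
def nilMap (c : ℕ) (ψ : FreeGroup X →* FreeGroup X) : NilQuot X c →* NilQuot X c :=
  QuotientGroup.map (dimSubgroup X c) (dimSubgroup X c) ψ fun f hf => by
    have := gmap_mem_augPow ψ (mem_dimSubgroup.1 hf)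
    rw [map_sub, gmap_single, map_one] at this
    exact this

@[simp] lemma nilMap_toNil (c : ℕ) (ψ : FreeGroup X →* FreeGroup X) (f : FreeGroup X) :
    nilMap c ψ (toNil c f) = toNil c (ψ f) := rfl

lemma nilMap_pow_toNil (c : ℕ) (ψ : FreeGroup X →* FreeGroup X) (i : ℕ) (f : FreeGroup X) :
    endPow (nilMap c ψ) i (toNil c f) = toNil c (endPow ψ i f) := by
  induction i generalizing f with
  | zero => rfl
  | succ i ih => rw [endPow_succ, endPow_succ, nilMap_toNil, ih]

/-- Some power of an endomorphism is injective on its image in the nilpotent quotient. -/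
lemma exists_nilMap_stable (c : ℕ) (ψ : FreeGroup X →* FreeGroup X) : ∃ i, ∀ x : NilQuot X c,
    endPow (nilMap c ψ) (i + 1) x = 1 → endPow (nilMap c ψ) i x = 1 := by
  have fin : Finite {w : List X // w.length < c} := (List.finite_length_lt X c).to_subtype
  let P : MonoidAlgebra ℤ (FreeGroup X) →ₗ[ℤ] ({w : List X // w.length < c} → ℤ) :=
    LinearMap.pi fun w => foxCoeff w.1
  have hP : ∀ a, P a = 0 ↔ a ∈ augPow X c := fun a => by
    rw [mem_augPow_iff, funext_iff, Subtype.forall]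
    rfl
  let K : ℕ → Submodule ℤ (MonoidAlgebra ℤ (FreeGroup X)) := fun i =>
    (augPow X c).comap ((gmap ℤ ψ).toLinearMap ^ i)
  have hK : ∀ i, K i ≤ K (i + 1) := fun i a ha => by
    simp only [K, Submodule.mem_comap] at ha ⊢
    rw [pow_succ', Module.End.mul_apply]
    exact gmap_mem_augPow ψ ha
  have hmono : Monotone fun i => (K i).map P :=
    monotone_nat_of_le_succ fun i => Submodule.map_mono (hK i)
  obtain ⟨i, hi⟩ := monotone_stabilizes_iff_noetherian.2
    (inferInstance : IsNoetherian ℤ ({w : List X // w.length < c} → ℤ)) ⟨_, hmono⟩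
  refine ⟨i, fun x hx => ?_⟩
  obtain ⟨f, rfl⟩ := toNil_surjective c x
  have key : ∀ j, endPow (nilMap c ψ) j (toNil c f) = 1 ↔
      (single f 1 - 1 : MonoidAlgebra ℤ (FreeGroup X)) ∈ K j := fun j => by
    rw [nilMap_pow_toNil, ← map_one (toNil c), eq_comm, toNil_eq_iff]
    simp only [K, Submodule.mem_comap, gmap_pow]
    rw [map_sub, gmap_single, map_one]
    rfl
  rw [key] at hx ⊢
  have h1 : P (single f 1 - 1) ∈ (K i).map P := by
    have := hi (i + 1) (Nat.le_succ i)
    simp only [OrderHom.coe_mk] at this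
    rw [this]
    exact Submodule.mem_map_of_mem hx
  obtain ⟨b, hb, hbe⟩ := h1
  have h2 : b - (single f 1 - 1) ∈ augPow X c := by
    rw [← hP, map_sub, hbe, sub_self]
  have h3 : b - (single f 1 - 1) ∈ K i := by
    simp only [K, Submodule.mem_comap, gmap_pow]
    exact gmap_mem_augPow _ h2
  have := sub_mem hb h3
  rwa [sub_sub_cancel] at this

/-- An endomorphism which is idempotent modulo `6` on the abelianization has no nontrivial
periodic points in the nilpotent quotients. -/
lemma nilMap_eq_self_of_periodic {ψ : FreeGroup X →* FreeGroup X}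
    (h : ∀ j, ∃ u ∈ augPow X 1, (single (ψ (ψ (.of j))) 1 - single (ψ (.of j)) 1 - (6 : ℤ) • u :
      MonoidAlgebra ℤ (FreeGroup X)) ∈ augPow X 2) {c q : ℕ} (hq : q ≠ 0) {x : NilQuot X c}
    (hx : endPow (nilMap c ψ) q x = x) : nilMap c ψ x = x := by
  obtain ⟨f, rfl⟩ := toNil_surjective c x
  rw [nilMap_pow_toNil, eq_comm, toNil_eq_iff] at hx
  rw [nilMap_toNil, eq_comm, toNil_eq_iff]
  set u : MonoidAlgebra ℤ (FreeGroup X) := single (ψ f) 1 - single f 1 with hu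
  suffices ∀ i ≤ c, u ∈ augPow X i from this c le_rfl
  intro i
  induction i with
  | zero => simp
  | succ i ih =>
    intro hic
    have hui := ih (by omega)
    let A := MonoidAlgebra ℤ (FreeGroup X) ⧸ augPow X (i + 1)
    let π : MonoidAlgebra ℤ (FreeGroup X) →ₗ[ℤ] A := (augPow X (i + 1)).mkQ
    have hπ : ∀ a, π a = 0 ↔ a ∈ augPow X (i + 1) := fun a => Submodule.Quotient.mk_eq_zero _
    have hπs : Function.Surjective π := Submodule.mkQ_surjective _
    let B : Module.End ℤ A := (augPow X (i + 1)).mapQ (augPow X (i + 1)) (gmap ℤ ψ).toLinearMap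
      fun a ha => gmap_mem_augPow ψ ha
    have hB : ∀ a, B (π a) = π (gmap ℤ ψ a) := fun a => rfl
    have hBk : ∀ k a, (B ^ k) (π a) = π (((gmap ℤ ψ).toLinearMap ^ k) a) := by
      intro k
      induction k with
      | zero => intro a; rfl
      | succ k ih =>
        intro a
        rw [pow_succ, Module.End.mul_apply, hB, ih, pow_succ, Module.End.mul_apply]
        rfl
    have tf : ∀ (n : ℤ) (a : A), n ≠ 0 → n • a = 0 → a = 0 := by
      intro n a hn ha
      obtain ⟨a, rfl⟩ := hπs a
      rw [← map_smul, hπ] at ha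
      exact (hπ a).2 (mem_augPow_of_smul_mem hn ha)
    have sep : ∀ p : ℕ, p.Prime → ∀ a : A, (∀ s : ℕ, ∃ b, a = ((p : ℤ) ^ s) • b) → a = 0 := by
      intro p hp a ha
      obtain ⟨a, rfl⟩ := hπs a
      rw [hπ]
      refine mem_augPow_of_separated hp fun s => ?_
      obtain ⟨b, hb⟩ := ha s
      obtain ⟨b, rfl⟩ := hπs b
      exact ⟨b, by rw [← hπ, map_sub, map_smul, hb, sub_self]⟩
    have hc : ∀ k, (B ^ k) (π (single f 1)) = π (single (endPow ψ k f) 1) := fun k => by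
      rw [hBk, gmap_pow, gmap_single]
    have hqf : (B ^ q) (π (single f 1)) = π (single f 1) := by
      rw [hc, ← sub_eq_zero, ← map_sub, hπ]
      exact augPow_antitone hic hx
    have hu' : π u = B (π (single f 1)) - π (single f 1) := by
      rw [hu, map_sub, hB, gmap_single]
    have hqu : (B ^ q) (π u) = π u := by
      rw [hu', map_sub, ← Module.End.mul_apply, ← pow_succ, pow_succ', Module.End.mul_apply, hqf]
    have fixed := eq_self_of_periodic (L := (augPow X i).map π) (B := B) tf sep
      (by
        rintro _ ⟨a, ha, rfl⟩
        exact ⟨_, gmap_mem_augPow ψ ha, rfl⟩)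
      (by
        rintro _ ⟨a, ha, rfl⟩
        obtain ⟨v, hv, hva⟩ := gmap_gmap_sub_mem h i ha
        refine ⟨π v, ⟨v, hv, rfl⟩, ?_⟩
        rw [hB, hB, ← map_sub, ← map_smul, ← sub_eq_zero, ← map_sub, hπ]
        exact hva) hq ⟨u, hui, rfl⟩ hqu
    have hsum : ∀ k : ℕ, (B ^ k) (π (single f 1)) = π (single f 1) + (k : ℤ) • π u := by
      intro k
      induction k with
      | zero => simp
      | succ k ihk =>
        rw [pow_succ', Module.End.mul_apply, ihk, map_add, map_smul, fixed]
        have := sub_eq_iff_eq_add.1 hu'.symm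
        rw [this, Nat.cast_succ, add_smul, one_smul]
        abel
    have := hsum q
    rw [hqf, left_eq_add] at this
    exact (hπ u).1 (tf _ _ (by exact_mod_cast hq) this)

end NilEndo

section GrowthOre

open scoped Pointwise

variable {k Γ : Type*} [Field k] [Group Γ]

lemma exists_of_coeff_mul_ne_zero {a b : MonoidAlgebra k Γ} {g : Γ} (h : (a * b).coeff g ≠ 0) :
    ∃ x y, a.coeff x ≠ 0 ∧ b.coeff y ≠ 0 ∧ x * y = g := by
  classical
  rw [coeff_mul] at h
  obtain ⟨x, hx, hx'⟩ := Finset.exists_ne_zero_of_sum_ne_zero h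
  obtain ⟨y, hy, hy'⟩ := Finset.exists_ne_zero_of_sum_ne_zero hx'
  refine ⟨x, y, Finsupp.mem_support_iff.1 hx, Finsupp.mem_support_iff.1 hy, ?_⟩
  by_contra hne
  simp [hne] at hy'

/-- A finite generating set of a group for which the balls grow slowly. -/
structure SlowGrowth [DecidableEq Γ] (B : Finset Γ) : Prop where
  one_mem : 1 ∈ B
  exists_mem_pow : ∀ g, ∃ r, g ∈ B ^ r
  exists_lt : ∀ {n m : ℕ} (s : ℕ), n < m → ∃ r, n * (B ^ (r + s)).card < m * (B ^ r).card

variable [DecidableEq Γ] {B : Finset Γ}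

lemma SlowGrowth.exists_subset_pow (hB : SlowGrowth B) (S : Finset Γ) : ∃ r, S ⊆ B ^ r := by
  induction S using Finset.induction_on with
  | empty => exact ⟨0, by simp⟩
  | insert g S _ ih =>
    obtain ⟨r, hr⟩ := ih
    obtain ⟨s, hs⟩ := hB.exists_mem_pow g
    refine ⟨r + s, Finset.insert_subset ?_ ?_⟩
    · exact Finset.pow_subset_pow_right hB.one_mem (by omega) hs
    · exact hr.trans (Finset.pow_subset_pow_right hB.one_mem (by omega))

/-- Over the group algebra of a group of slow growth, a matrix with more rows than columns has a
nonzero left null vector. -/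
lemma SlowGrowth.exists_null_vector (hB : SlowGrowth B) {ι κ : Type*} [Fintype ι] [Fintype κ]
    (hlt : Fintype.card κ < Fintype.card ι) (M : ι → κ → MonoidAlgebra k Γ) :
    ∃ b : ι → MonoidAlgebra k Γ, b ≠ 0 ∧ ∀ j, ∑ i, b i * M i j = 0 := by
  classical
  obtain ⟨s, hs⟩ := hB.exists_subset_pow
    (Finset.univ.biUnion fun p : ι × κ => (M p.1 p.2).coeff.support)
  have hs' : ∀ i j g, (M i j).coeff g ≠ 0 → g ∈ B ^ s := fun i j g hg =>
    hs (Finset.mem_biUnion.2 ⟨(i, j), Finset.mem_univ _, Finsupp.mem_support_iff.2 hg⟩)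
  obtain ⟨r, hr⟩ := hB.exists_lt s hlt
  let E : ((B ^ r : Finset Γ) → k) →ₗ[k] MonoidAlgebra k Γ :=
    ∑ g : (B ^ r : Finset Γ), (LinearMap.proj g).smulRight (single g.1 1)
  have hE : ∀ v (g : (B ^ r : Finset Γ)), (E v).coeff g.1 = v g := by
    intro v g
    simp only [E, LinearMap.sum_apply, LinearMap.smulRight_apply, LinearMap.proj_apply,
      smul_single, smul_eq_mul, mul_one, coeff_sum, Finsupp.finsetSum_apply, coeff_single]
    rw [Finset.sum_eq_single g]
    · simp
    · intro x _ hx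
      exact Finsupp.single_eq_of_ne (fun h => hx (Subtype.ext h.symm))
    · simp
  have hE' : ∀ v g, (E v).coeff g ≠ 0 → g ∈ B ^ r := by
    intro v g hg
    by_contra hn
    apply hg
    simp only [E, LinearMap.sum_apply, LinearMap.smulRight_apply, LinearMap.proj_apply,
      smul_single, smul_eq_mul, mul_one, coeff_sum, Finsupp.finsetSum_apply, coeff_single]
    refine Finset.sum_eq_zero fun x _ => Finsupp.single_eq_of_ne ?_
    rintro rfl
    exact hn x.2
  let T : (ι → (B ^ r : Finset Γ) → k) →ₗ[k] (κ → (B ^ (r + s) : Finset Γ) → k) :=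
    { toFun := fun c j g => (∑ i, E (c i) * M i j).coeff g.1
      map_add' := fun c c' => by
        ext j g
        simp [add_mul, Finset.sum_add_distrib]
      map_smul' := fun x c => by
        ext j g
        simp [← Finset.smul_sum] }
  have hker : LinearMap.ker T ≠ ⊥ := by
    apply LinearMap.ker_ne_bot_of_finrank_lt
    simpa [Module.finrank_pi_fintype] using hr
  obtain ⟨c, hc, hc0⟩ := Submodule.exists_mem_ne_zero_of_ne_bot hker
  refine ⟨fun i => E (c i), fun h => hc0 ?_, fun j => ?_⟩
  · ext i g
    have := hE (c i) g
    rw [congrFun h i] at this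
    simpa using this.symm
  · refine MonoidAlgebra.ext (Finsupp.ext fun g => ?_)
    by_cases hg : g ∈ B ^ (r + s)
    · exact congrFun (congrFun (LinearMap.mem_ker.1 hc) j) ⟨g, hg⟩
    · simp only [coeff_sum, Finsupp.finsetSum_apply]
      refine Finset.sum_eq_zero fun i _ => ?_
      by_contra hne
      obtain ⟨x, y, hx, hy, rfl⟩ := exists_of_coeff_mul_ne_zero hne
      apply hg
      rw [pow_add]
      exact Finset.mul_mem_mul (hE' _ _ hx) (hs' _ _ _ hy)

/-- The left Ore condition. -/
lemma SlowGrowth.exists_mul_eq_mul [NoZeroDivisors (MonoidAlgebra k Γ)] (hB : SlowGrowth B)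
    {a b : MonoidAlgebra k Γ} (ha : a ≠ 0) (hb : b ≠ 0) :
    ∃ u v, u ≠ 0 ∧ v ≠ 0 ∧ u * a = v * b := by
  obtain ⟨w, hw, h⟩ := hB.exists_null_vector (ι := Fin 2) (κ := Fin 1) (by simp)
    (fun i _ => if i = 0 then a else b)
  have h0 : w 0 * a + w 1 * b = 0 := by simpa [Fin.sum_univ_two] using h 0
  have h0' : w 0 * a = -w 1 * b := by rw [neg_mul]; exact eq_neg_of_add_eq_zero_left h0
  have hw0 : w 0 ≠ 0 := by
    intro h1
    have h2 : w 1 = 0 := by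
      rw [h1, zero_mul, zero_add] at h0
      exact (mul_eq_zero.1 h0).resolve_right hb
    exact hw (funext fun i => by fin_cases i <;> assumption)
  refine ⟨w 0, -w 1, hw0, fun h1 => ?_, h0'⟩
  rw [h1, zero_mul] at h0'
  exact (mul_ne_zero hw0 ha) h0'

end GrowthOre

section Lead

variable {k Γ : Type*} [Field k] [Group Γ] [LinearOrder Γ]

/-- `g` is the largest element of the support of `a`. -/
def IsLead (a : MonoidAlgebra k Γ) (g : Γ) : Prop := a.coeff g ≠ 0 ∧ ∀ h, a.coeff h ≠ 0 → h ≤ g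

lemma exists_isLead {a : MonoidAlgebra k Γ} (ha : a ≠ 0) : ∃ g, IsLead a g := by
  have hne : a.coeff.support.Nonempty := by
    rw [Finsupp.support_nonempty_iff]
    simpa using ha
  refine ⟨a.coeff.support.max' hne, ?_, fun h hh => ?_⟩
  · exact Finsupp.mem_support_iff.1 (Finset.max'_mem _ hne)
  · exact Finset.le_max' _ _ (Finsupp.mem_support_iff.2 hh)

lemma IsLead.unique {a : MonoidAlgebra k Γ} {g h : Γ} (hg : IsLead a g) (hh : IsLead a h) :
    g = h := le_antisymm (hh.2 _ hg.1) (hg.2 _ hh.1)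

lemma IsLead.mul [MulLeftStrictMono Γ] [MulRightStrictMono Γ] {a b : MonoidAlgebra k Γ} {g h : Γ}
    (hg : IsLead a g) (hh : IsLead b h) : IsLead (a * b) (g * h) := by
  have := mulLeftMono_of_mulLeftStrictMono Γ
  have := mulRightMono_of_mulRightStrictMono Γ
  refine ⟨?_, fun x hx => ?_⟩
  · rw [coeff_mul_mul_of_uniqueMul]
    · exact mul_ne_zero hg.1 hh.1
    · intro x y hx hy hxy
      have h1 := hg.2 x (Finsupp.mem_support_iff.1 hx)
      have h2 := hh.2 y (Finsupp.mem_support_iff.1 hy)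
      rcases h1.lt_or_eq with h1 | h1
      · exact absurd hxy (mul_lt_mul_of_lt_of_le h1 h2).ne
      · subst h1
        exact ⟨rfl, mul_left_cancel hxy⟩
  · obtain ⟨y, z, hy, hz, rfl⟩ := exists_of_coeff_mul_ne_zero hx
    exact mul_le_mul' (hg.2 _ hy) (hh.2 _ hz)

lemma isLead_single (g : Γ) : IsLead (single g 1 : MonoidAlgebra k Γ) g := by
  refine ⟨by simp, fun h hh => ?_⟩
  by_contra hne
  rw [coeff_single, Finsupp.single_eq_of_ne (by rintro rfl; exact hne le_rfl)] at hh
  exact hh rfl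

lemma gmap_injective {k : Type*} [CommRing k] {G H : Type*} [Group G] [Group H] {f : G →* H} (hf : Function.Injective f) :
    Function.Injective (gmap k f) := fun a b h => by
  rw [gmap_apply, gmap_apply] at h
  exact mapDomain_injective hf h

lemma coeff_gmap {k : Type*} [CommRing k] {G H : Type*} [Group G] [Group H] {f : G →* H} (hf : Function.Injective f)
    (a : MonoidAlgebra k G) (g : G) : (gmap k f a).coeff (f g) = a.coeff g :=
  Finsupp.mapDomain_apply hf _ _

lemma exists_of_coeff_gmap_ne_zero {k : Type*} [CommRing k] {G H : Type*} [Group G] [Group H] {f : G →* H}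
    {a : MonoidAlgebra k G} {h : H} (hh : (gmap k f a).coeff h ≠ 0) : ∃ g, f g = h ∧ a.coeff g ≠ 0 := by
  classical
  have := Finsupp.mapDomain_support (Finsupp.mem_support_iff.2 hh)
  obtain ⟨g, hg, rfl⟩ := Finset.mem_image.1 this
  exact ⟨g, rfl, Finsupp.mem_support_iff.1 hg⟩

lemma IsLead.gmap {N : Type*} [Group N] [LinearOrder N] {ι : Γ →* N} (hι : StrictMono ι)
    {a : MonoidAlgebra k Γ} {g : Γ} (hg : IsLead a g) : IsLead (gmap k ι a) (ι g) := by
  refine ⟨by rw [coeff_gmap hι.injective]; exact hg.1, fun h hh => ?_⟩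
  obtain ⟨x, rfl, hx⟩ := exists_of_coeff_gmap_ne_zero hh
  exact hι.monotone (hg.2 x hx)

/-- Finitely many nonzero elements with distinct leading terms do not add up to zero. -/
lemma eq_zero_of_sum_eq_zero {T : Type*} (s : Finset T) (e : T → MonoidAlgebra k Γ)
    (hd : ∀ x ∈ s, ∀ y ∈ s, ∀ g, IsLead (e x) g → IsLead (e y) g → x = y)
    (h0 : ∑ x ∈ s, e x = 0) : ∀ x ∈ s, e x = 0 := by
  classical
  by_contra! hcon
  obtain ⟨x, hx, hx0⟩ := hcon
  choose! l hl using fun a : MonoidAlgebra k Γ => exists_isLead (a := a)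
  obtain ⟨y, hy, hmax⟩ := (s.filter fun x => e x ≠ 0).exists_max_image (fun x => l (e x))
    ⟨x, Finset.mem_filter.2 ⟨hx, hx0⟩⟩
  rw [Finset.mem_filter] at hy
  have h1 : (∑ x ∈ s, e x).coeff (l (e y)) = (e y).coeff (l (e y)) := by
    simp only [coeff_sum, Finsupp.finsetSum_apply]
    refine Finset.sum_eq_single_of_mem y hy.1 fun z hz hzy => ?_
    by_contra hne
    have hz0 : e z ≠ 0 := by rintro h; simp [h] at hne
    have h2 := (hl _ hz0).2 _ hne
    have h3 := hmax z (Finset.mem_filter.2 ⟨hz, hz0⟩)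
    have h4 := le_antisymm h3 h2
    exact hzy (hd z hz y hy.1 _ (hl _ hz0) (h4 ▸ hl _ hy.2))
  rw [h0] at h1
  exact (hl _ hy.2).1 h1.symm

/-- If `a` and `e` are transformed in the same way by an endomorphism without nontrivial
periodic points, then their leading terms differ by a fixed element. -/
lemma lead_eq_mul_fixed [MulLeftStrictMono Γ] [MulRightStrictMono Γ] {σ : Γ →* Γ}
    (hσ : Function.Injective σ) (hper : ∀ q ≠ 0, ∀ g, endPow σ q g = g → σ g = g)
    {a e u v : MonoidAlgebra k Γ} (hu : u ≠ 0) (hv : v ≠ 0) (ha : a ≠ 0) (he : e ≠ 0)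
    (hua : u * gmap k σ a = v * a) (hue : u * gmap k σ e = v * e) {x y : Γ}
    (hx : IsLead a x) (hy : IsLead e y) : ∃ z, σ z = z ∧ y = x * z := by
  classical
  choose! l hl using fun a : MonoidAlgebra k Γ => exists_isLead (a := a)
  have hinj : ∀ j, Function.Injective (endPow σ j) := by
    intro j
    induction j with
    | zero => exact fun _ _ h => h
    | succ j ih => exact ih.comp hσ
  have hne : ∀ j (b : MonoidAlgebra k Γ), b ≠ 0 → gmap k (endPow σ j) b ≠ 0 := fun j b hb h =>
    hb (gmap_injective (hinj j) (by rw [h, map_zero]))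
  have hcomp : ∀ j (b : MonoidAlgebra k Γ),
      gmap k (endPow σ j) (gmap k σ b) = gmap k (endPow σ (j + 1)) b := fun j b => gmap_gmap ..
  let A : ℕ → Γ := fun j => l (gmap k (endPow σ j) a)
  let E : ℕ → Γ := fun j => l (gmap k (endPow σ j) e)
  have hA : ∀ j, IsLead (gmap k (endPow σ j) a) (A j) := fun j => hl _ (hne j a ha)
  have hE : ∀ j, IsLead (gmap k (endPow σ j) e) (E j) := fun j => hl _ (hne j e he)
  have step : ∀ j, (A (j + 1))⁻¹ * E (j + 1) = (A j)⁻¹ * E j := by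
    intro j
    have key : ∀ b : MonoidAlgebra k Γ, b ≠ 0 → u * gmap k σ b = v * b →
        l (gmap k (endPow σ j) u) * l (gmap k (endPow σ (j + 1)) b) =
        l (gmap k (endPow σ j) v) * l (gmap k (endPow σ j) b) := by
      intro b hb hub
      have h1 := congrArg (gmap k (endPow σ j)) hub
      rw [map_mul, map_mul, hcomp] at h1
      have h2 := (hl _ (hne j u hu)).mul (hl _ (hne (j + 1) b hb))
      rw [h1] at h2
      exact h2.unique ((hl _ (hne j v hv)).mul (hl _ (hne j b hb)))
    have k1 := key a ha hua
    have k2 := key e he hue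
    have : A (j + 1) = (l (gmap k (endPow σ j) u))⁻¹ * (l (gmap k (endPow σ j) v) * A j) := by
      rw [eq_inv_mul_iff_mul_eq]; exact k1
    rw [this]
    have : E (j + 1) = (l (gmap k (endPow σ j) u))⁻¹ * (l (gmap k (endPow σ j) v) * E j) := by
      rw [eq_inv_mul_iff_mul_eq]; exact k2
    rw [this]
    group
  have const : ∀ j, (A j)⁻¹ * E j = (A 0)⁻¹ * E 0 := by
    intro j
    induction j with
    | zero => rfl
    | succ j ih => rw [step, ih]
  have hA' : ∀ j, ∃ g, endPow σ j g = A j ∧ a.coeff g ≠ 0 := fun j =>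
    exists_of_coeff_gmap_ne_zero (hA j).1
  have hE' : ∀ j, ∃ g, endPow σ j g = E j ∧ e.coeff g ≠ 0 := fun j =>
    exists_of_coeff_gmap_ne_zero (hE j).1
  choose A' hA1 hA2 using hA'
  choose E' hE1 hE2 using hE'
  let F : ℕ → a.coeff.support × e.coeff.support := fun j =>
    (⟨A' j, Finsupp.mem_support_iff.2 (hA2 j)⟩, ⟨E' j, Finsupp.mem_support_iff.2 (hE2 j)⟩)
  obtain ⟨i, j, hij, hF⟩ : ∃ i j, i < j ∧ F i = F j := by
    obtain ⟨i, j, hne, h⟩ := Finite.exists_ne_map_eq_of_infinite F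
    rcases lt_or_gt_of_ne hne with h' | h'
    · exact ⟨i, j, h', h⟩
    · exact ⟨j, i, h', h.symm⟩
  have hFA : A' i = A' j := congrArg (fun p => (p.1 : Γ)) hF
  have hFE : E' i = E' j := congrArg (fun p => (p.2 : Γ)) hF
  have hgi : endPow σ i ((A' i)⁻¹ * E' i) = (A 0)⁻¹ * E 0 := by
    rw [map_mul, map_inv, hA1, hE1, const]
  have hgj : endPow σ j ((A' i)⁻¹ * E' i) = (A 0)⁻¹ * E 0 := by
    rw [hFA, hFE, map_mul, map_inv, hA1, hE1, const]
  have hid : ∀ b : MonoidAlgebra k Γ, gmap k (endPow σ 0) b = b := by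
    intro b
    induction b using MonoidAlgebra.induction_linear with
    | zero => simp
    | add a b h h' => simp only [map_add, h, h']
    | single f r => simp
  have h0A : A 0 = x := by
    have := hA 0
    rw [hid] at this
    exact this.unique hx
  have h0E : E 0 = y := by
    have := hE 0
    rw [hid] at this
    exact this.unique hy
  rw [h0A, h0E] at hgi hgj
  refine ⟨x⁻¹ * y, hper (j - i) (by omega) _ ?_, by group⟩
  conv_lhs => rw [← hgi]
  rw [← endPow_add, Nat.sub_add_cancel hij.le, hgj]

end Lead

section RankBound

variable {k : Type*} [Field k] {X N Γ : Type*} [Group N] [Group Γ]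

lemma endPow_eq_self {G : Type*} [Group G] {ψ : G →* G} {x : G} (h : ψ x = x) (i : ℕ) :
    endPow ψ i x = x := by
  induction i with
  | zero => rfl
  | succ i ih => rw [endPow_succ, h, ih]

/-- The part of an element of the group algebra supported on a coset. -/
noncomputable def cosetPart [DecidableEq X] (q : FreeGroup X →* Γ) (r : FreeGroup X → FreeGroup X)
    (τ : FreeGroup X) : MonoidAlgebra k (FreeGroup X) →ₗ[k] MonoidAlgebra k Γ :=
  linExt fun f => if r f = τ then single (q (f * (r f)⁻¹)) 1 else 0

lemma linExt_eq_sum_cosetPart [DecidableEq X] {H : Subgroup (FreeGroup X)}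
    {r : FreeGroup X → FreeGroup X}
    (hrm : ∀ f, f * (r f)⁻¹ ∈ H) {θ : FreeGroup X →* N} {q : FreeGroup X →* Γ} {ι : Γ →* N}
    (hιq : ∀ h ∈ H, ι (q h) = θ h) {G : FreeGroup X → MonoidAlgebra k N}
    (hG : ∀ h ∈ H, ∀ f, G (h * f) = single (θ h) 1 * G f)
    {T : Finset (FreeGroup X)} {x : MonoidAlgebra k (FreeGroup X)}
    (hT : ∀ f, x.coeff f ≠ 0 → r f ∈ T) :
    linExt G x = ∑ τ ∈ T, gmap k ι (cosetPart q r τ x) * G τ := by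
  simp only [cosetPart, linExt_apply, Finsupp.sum, map_sum, Finset.sum_mul]
  rw [Finset.sum_comm]
  refine Finset.sum_congr rfl fun f hf => ?_
  rw [Finset.sum_eq_single_of_mem (r f) (hT f (Finsupp.mem_support_iff.1 hf))]
  · rw [if_pos rfl, map_smul, gmap_single, hιq _ (hrm f), smul_mul_assoc, ← hG _ (hrm f),
      inv_mul_cancel_right]
  · intro τ _ hτ
    rw [if_neg hτ.symm]
    simp

lemma gmap_cosetPart [DecidableEq X] {q : FreeGroup X →* Γ} {r : FreeGroup X → FreeGroup X}
    {σ : Γ →* Γ} (hσ : ∀ f, σ (q (f * (r f)⁻¹)) = q (f * (r f)⁻¹)) (τ : FreeGroup X)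
    (x : MonoidAlgebra k (FreeGroup X)) :
    gmap k σ (cosetPart q r τ x) = cosetPart q r τ x := by
  simp only [cosetPart, linExt_apply, Finsupp.sum, map_sum]
  refine Finset.sum_congr rfl fun f _ => ?_
  split_ifs
  · rw [map_smul, gmap_single, hσ]
  · simp

variable [Fintype X] [DecidableEq X]

lemma linExt_sub_linExt_one {A : Type*} [AddCommGroup A] [Module k A] (D : FreeGroup X → A)
    (f : FreeGroup X) :
    D f - D 1 = ∑ j, linExt (fun g => D (g * .of j) - D g) (fox k j f) := by
  have key : ∀ j (a : MonoidAlgebra k (FreeGroup X)),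
      linExt D (a * (single (.of j) 1 - 1)) = linExt (fun g => D (g * .of j) - D g) a := by
    intro j a
    induction a using MonoidAlgebra.induction_linear with
    | zero => simp
    | add a b h h' => simp only [add_mul, map_add, h, h']
    | single g c => simp [mul_sub, single_mul_single, smul_sub]
  have := congrArg (linExt D) (fox_fundamental (R := k) f)
  rw [map_sub, map_sum, linExt_single, one_def, linExt_single, one_smul, one_smul] at this
  rw [this]
  exact Finset.sum_congr rfl fun j _ => key j _

/-- Minimal null vectors are transformed into multiples of themselves by an endomorphism. -/
lemma exists_minimal_null_vector [NoZeroDivisors (MonoidAlgebra k Γ)] [DecidableEq Γ]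
    {B : Finset Γ} (hB : SlowGrowth B) {m : ℕ} (hm : Fintype.card X < m)
    {σ : Γ →* Γ} (hσ : Function.Injective σ) (M : Fin m → X → MonoidAlgebra k Γ)
    (J : X → X → MonoidAlgebra k Γ) (hMJ : ∀ i j, M i j = ∑ l, gmap k σ (M i l) * J l j) :
    ∃ b : Fin m → MonoidAlgebra k Γ, (∀ j, ∑ i, b i * M i j = 0) ∧
      ∃ i₀, b i₀ ≠ 0 ∧ ∃ u v, u ≠ 0 ∧ v ≠ 0 ∧ ∀ i, u * gmap k σ (b i) = v * b i := by
  classical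
  let P : ℕ → Prop := fun n => ∃ b : Fin m → MonoidAlgebra k Γ, b ≠ 0 ∧
    (∀ j, ∑ i, b i * M i j = 0) ∧ (Finset.univ.filter fun i => b i ≠ 0).card = n
  have hP : ∃ n, P n := by
    obtain ⟨b, hb, hbM⟩ := hB.exists_null_vector (by simpa using hm) M
    exact ⟨_, b, hb, hbM, rfl⟩
  obtain ⟨b, hb, hbM, hbn⟩ := Nat.find_spec hP
  obtain ⟨i₀, hi₀⟩ := Function.ne_iff.1 hb
  have hσ0 : ∀ a : MonoidAlgebra k Γ, a ≠ 0 → gmap k σ a ≠ 0 := fun a ha h =>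
    ha (gmap_injective hσ (by rw [h, map_zero]))
  obtain ⟨u, v, hu, hv, huv⟩ := hB.exists_mul_eq_mul (hσ0 _ hi₀) hi₀
  refine ⟨b, hbM, i₀, hi₀, u, v, hu, hv, fun i => ?_⟩
  by_contra hne
  refine Nat.find_min hP (m := (Finset.univ.filter
    fun i => u * gmap k σ (b i) - v * b i ≠ 0).card) ?_
    ⟨fun i => u * gmap k σ (b i) - v * b i, fun h => hne (sub_eq_zero.1 (congrFun h i)), ?_, rfl⟩
  · rw [← hbn]
    refine Finset.card_lt_card ⟨fun i hi => ?_, fun h => ?_⟩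
    · rw [Finset.mem_filter] at hi ⊢
      refine ⟨hi.1, fun h0 => hi.2 ?_⟩
      rw [h0, map_zero, mul_zero, mul_zero, sub_zero]
    · have := h (Finset.mem_filter.2 ⟨Finset.mem_univ i₀, hi₀⟩)
      rw [Finset.mem_filter] at this
      exact this.2 (sub_eq_zero.2 huv)
  · intro j
    have h1 : ∑ i, gmap k σ (b i) * M i j = 0 := by
      calc ∑ i, gmap k σ (b i) * M i j
          = ∑ i, ∑ l, gmap k σ (b i * M i l) * J l j := by
            refine Finset.sum_congr rfl fun i _ => ?_
            rw [hMJ, Finset.mul_sum]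
            exact Finset.sum_congr rfl fun l _ => by rw [map_mul, mul_assoc]
        _ = ∑ l, gmap k σ (∑ i, b i * M i l) * J l j := by
            rw [Finset.sum_comm]
            simp only [map_sum, Finset.sum_mul]
        _ = 0 := by simp [hbM]
    simp only [sub_mul, mul_assoc, Finset.sum_sub_distrib, ← Finset.mul_sum, h1, hbM, mul_zero,
      sub_zero]

variable [LinearOrder N] [MulLeftStrictMono N] [MulRightStrictMono N]
  [LinearOrder Γ] [MulLeftStrictMono Γ] [MulRightStrictMono Γ]

theorem card_le_of_slowGrowth (k : Type*) [Field k] [NoZeroDivisors (MonoidAlgebra k Γ)]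
    (ψ : FreeGroup X →* FreeGroup X)
    {H : Subgroup (FreeGroup X)} (hH : ∀ h ∈ H, ψ h = h) {r : FreeGroup X → FreeGroup X}
    (hr1 : r 1 = 1) (hr : ∀ h ∈ H, ∀ f, r (h * f) = r f) (hrm : ∀ f, f * (r f)⁻¹ ∈ H)
    {Y : Type*} (e : FreeGroup Y ≃* H) {m : ℕ} {y : Fin m → Y} (hy : Function.Injective y)
    {T : Finset (FreeGroup X)}
    (hT : ∀ i j f, (fox k j (e (.of (y i))).1).coeff f ≠ 0 → r f ∈ T)
    {θ : FreeGroup X →* N} {q : FreeGroup X →* Γ} {ι : Γ →* N} (hι : StrictMono ι)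
    {σ : Γ →* Γ} (hσ : Function.Injective σ) (hσq : ∀ f, σ (q f) = q (ψ f)) {i₀ : ℕ}
    (hιq : ∀ f, ι (q f) = θ (endPow ψ i₀ f))
    (hper : ∀ n ≠ 0, ∀ g, endPow σ n g = g → σ g = g)
    (hsep : ∀ τ ∈ T, ∀ τ' ∈ T, ∀ z z', σ z = z → σ z' = z' → ι z * θ τ = ι z' * θ τ' → τ = τ')
    {B : Finset Γ} (hB : SlowGrowth B) : m ≤ Fintype.card X := by
  classical
  by_contra! hm
  let h : Fin m → FreeGroup X := fun i => (e (.of (y i))).1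
  have hhH : ∀ i, h i ∈ H := fun i => (e (.of (y i))).2
  have hιqH : ∀ f ∈ H, ι (q f) = θ f := fun f hf => by rw [hιq, endPow_eq_self (hH f hf)]
  let M : Fin m → X → MonoidAlgebra k (FreeGroup X) := fun i j => fox k j (h i)
  obtain ⟨b, hbM, i₁, hi₁, u, v, hu, hv, huv⟩ := exists_minimal_null_vector hB hm hσ
    (fun i j => gmap k q (M i j)) (fun l j => gmap k q (fox k j (ψ (.of l)))) (by
      intro i j
      conv_lhs => rw [show M i j = fox k j (ψ (h i)) by rw [hH _ (hhH i)], fox_map, map_sum]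
      refine Finset.sum_congr rfl fun l _ => ?_
      rw [map_mul, gmap_gmap, gmap_gmap]
      congr 2
      congr 1
      ext x
      simp [hσq])
  let E : FreeGroup X → X → MonoidAlgebra k Γ := fun τ j => ∑ i, b i * cosetPart q r τ (M i j)
  have hE : ∀ τ j, u * gmap k σ (E τ j) = v * E τ j := by
    intro τ j
    simp only [E, map_sum, map_mul, Finset.mul_sum]
    refine Finset.sum_congr rfl fun i _ => ?_
    rw [gmap_cosetPart (fun f => by rw [hσq, hH _ (hrm f)]), ← mul_assoc, huv, mul_assoc]
  have expand : ∀ (G : FreeGroup X → MonoidAlgebra k N),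
      (∀ h ∈ H, ∀ f, G (h * f) = single (θ h) 1 * G f) → ∀ j,
      ∑ i, gmap k ι (b i) * linExt G (M i j) = ∑ τ ∈ T, gmap k ι (E τ j) * G τ := by
    intro G hG j
    have : ∀ i, linExt G (M i j) = ∑ τ ∈ T, gmap k ι (cosetPart q r τ (M i j)) * G τ :=
      fun i => linExt_eq_sum_cosetPart hrm hιqH hG (hT i j)
    simp only [this, E, map_sum, Finset.mul_sum, Finset.sum_mul, map_mul, mul_assoc]
    exact Finset.sum_comm
  have hE0 : ∀ j, ∀ τ ∈ T, E τ j = 0 := by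
    intro j
    have h1 : ∑ τ ∈ T, gmap k ι (E τ j) * single (θ τ) 1 = 0 := by
      rw [← expand (fun f => single (θ f) 1)
        (fun h _ f => by rw [map_mul, single_mul_single, one_mul]) j]
      have h2 : ∀ a : MonoidAlgebra k (FreeGroup X),
          linExt (fun f => (single (θ f) 1 : MonoidAlgebra k N)) a = gmap k θ a := by
        intro a
        induction a using MonoidAlgebra.induction_linear with
        | zero => simp
        | add a b h h' => simp only [map_add, h, h']
        | single f r => simp
      have h3 : ∀ i, gmap k θ (M i j) = ∑ l, gmap k ι (gmap k q (M i l)) *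
          gmap k θ (fox k j (endPow ψ i₀ (.of l))) := by
        intro i
        conv_lhs => rw [show M i j = fox k j (endPow ψ i₀ (h i)) by
          rw [endPow_eq_self (hH _ (hhH i))], fox_map, map_sum]
        refine Finset.sum_congr rfl fun l _ => ?_
        rw [map_mul, gmap_gmap, gmap_gmap]
        congr 2
        congr 1
        ext x
        simp [hιq]
      simp only [h2, h3, Finset.mul_sum, ← mul_assoc, ← map_mul]
      rw [Finset.sum_comm]
      simp only [← Finset.sum_mul, ← map_sum, hbM, map_zero, zero_mul, Finset.sum_const_zero]
    have h4 := eq_zero_of_sum_eq_zero T (fun τ => gmap k ι (E τ j) * single (θ τ) 1) ?_ h1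
    · intro τ hτ
      have h5 := congrArg (· * single (θ τ)⁻¹ 1) (h4 τ hτ)
      simp only [mul_assoc, single_mul_single, mul_inv_cancel, mul_one, zero_mul, ← one_def] at h5
      exact gmap_injective hι.injective (by rw [h5, map_zero])
    · intro τ hτ τ' hτ' g hg hg'
      have h5 : ∀ τ, IsLead (gmap k ι (E τ j) * single (θ τ) 1) g →
          ∃ z x, σ z = z ∧ IsLead (b i₁) x ∧ g = ι x * ι z * θ τ := by
        intro τ hg
        have hne : E τ j ≠ 0 := by
          intro h0
          rw [h0, map_zero, zero_mul] at hg
          exact hg.1 rfl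
        obtain ⟨y, hy⟩ := exists_isLead hne
        obtain ⟨x, hx⟩ := exists_isLead hi₁
        obtain ⟨z, hz, rfl⟩ := lead_eq_mul_fixed hσ hper hu hv hi₁ hne (huv i₁) (hE τ j) hx hy
        refine ⟨z, x, hz, hx, ?_⟩
        rw [← map_mul]
        exact hg.unique ((hy.gmap hι).mul (isLead_single _))
      obtain ⟨z, x, hz, hx, h6⟩ := h5 τ hg
      obtain ⟨z', x', hz', hx', h7⟩ := h5 τ' hg'
      rw [hx'.unique hx, h6, mul_assoc, mul_assoc, mul_right_inj] at h7
      exact hsep τ hτ τ' hτ' z z' hz hz' h7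
  let ρ : FreeGroup Y →* MonoidAlgebra k N :=
    (MonoidAlgebra.of k N).comp (θ.comp (H.subtype.comp e.toMonoidHom))
  let D₀ : FreeGroup Y → MonoidAlgebra k N :=
    crossed ρ fun y' => if y' = y i₁ then 1 else 0
  let D : FreeGroup X → MonoidAlgebra k N := fun f => D₀ (e.symm ⟨f * (r f)⁻¹, hrm f⟩)
  have hD : ∀ h (hh : h ∈ H) f, D (h * f) = D₀ (e.symm ⟨h, hh⟩) + single (θ h) 1 * D f := by
    intro h hh f
    have h1 : (⟨h * f * (r (h * f))⁻¹, hrm (h * f)⟩ : H) = ⟨h, hh⟩ * ⟨f * (r f)⁻¹, hrm f⟩ := by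
      ext
      simp [hr h hh f, mul_assoc]
    simp only [D]
    rw [h1, map_mul]
    simp only [D₀]
    rw [crossed_mul, smul_eq_mul]
    simp [ρ]
  have hD1 : D 1 = 0 := by
    have h1 : (⟨1 * (r 1)⁻¹, hrm 1⟩ : H) = 1 := by ext; simp [hr1]
    simp only [D]
    rw [h1, map_one]
    exact crossed_one ..
  have hDh : ∀ i, D (h i) = if i = i₁ then 1 else 0 := by
    intro i
    have h1 := hD (h i) (hhH i) 1
    rw [mul_one, hD1, mul_zero, add_zero] at h1
    rw [h1, show (⟨h i, hhH i⟩ : H) = e (.of (y i)) from rfl, e.symm_apply_apply]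
    simp only [D₀]
    rw [crossed_of]
    simp [hy.eq_iff]
  have final : ∑ i, gmap k ι (b i) * D (h i) = 0 := by
    have h1 : ∀ i, D (h i) = ∑ j, linExt (fun g => D (g * .of j) - D g) (M i j) := fun i => by
      rw [← linExt_sub_linExt_one D (h i), hD1, sub_zero]
    simp only [h1, Finset.mul_sum]
    rw [Finset.sum_comm]
    refine Finset.sum_eq_zero fun j _ => ?_
    rw [expand _ (fun h hh f => ?_) j]
    · exact Finset.sum_eq_zero fun τ hτ => by rw [hE0 j τ hτ, map_zero, zero_mul]
    · rw [mul_assoc, hD h hh, hD h hh, mul_sub]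
      abel
  simp only [hDh, mul_ite, mul_one, mul_zero, Finset.sum_ite_eq', Finset.mem_univ, if_true]
    at final
  exact hi₁ (gmap_injective hι.injective (by rw [final, map_zero]))

end RankBound

section FixedBound

/-- A choice of representatives of the right cosets of a subgroup. -/
lemma exists_coset_representatives {G : Type*} [Group G] (H : Subgroup G) : ∃ r : G → G,
    r 1 = 1 ∧ (∀ h ∈ H, ∀ f, r (h * f) = r f) ∧ ∀ f, f * (r f)⁻¹ ∈ H := by
  let p : G → Quotient (QuotientGroup.rightRel H) := Quotient.mk _
  let r₀ : G → G := fun f => (p f).out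
  have h0 : ∀ f, f * (r₀ f)⁻¹ ∈ H := fun f =>
    QuotientGroup.rightRel_apply.1 (Quotient.exact (Quotient.out_eq (p f)))
  have h1 : ∀ h ∈ H, ∀ f, r₀ (h * f) = r₀ f := by
    intro h hh f
    have : p (h * f) = p f := Quotient.sound (QuotientGroup.rightRel_apply.2 (by
      simpa using inv_mem hh))
    simp only [r₀, this]
  have h2 := h0 1
  rw [one_mul] at h2
  refine ⟨fun f => (r₀ 1)⁻¹ * r₀ f, by simp, fun h hh f => by simp only [h1 h hh], fun f => ?_⟩
  rw [mul_inv_rev, inv_inv, ← mul_assoc]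
  have := mul_mem (h0 f) (inv_mem h2)
  rwa [inv_inv] at this

variable {X : Type} [DecidableEq X] [Fintype X]

lemma exists_separating_degree (ψ : FreeGroup X →* FreeGroup X) (S : Finset (FreeGroup X)) :
    ∃ c, ∀ g ∈ S, (single (ψ g) 1 - single g 1 : MonoidAlgebra ℤ (FreeGroup X)) ∈ augPow X c →
      ψ g = g := by
  induction S using Finset.induction_on with
  | empty => exact ⟨0, by simp⟩
  | insert g S _ ih =>
    obtain ⟨c, hc⟩ := ih
    by_cases hg : ψ g = g
    · refine ⟨c, fun f hf hfc => ?_⟩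
      rcases Finset.mem_insert.1 hf with rfl | hf
      · exact hg
      · exact hc f hf hfc
    · have : ∃ d, (single (g⁻¹ * ψ g) 1 - 1 : MonoidAlgebra ℤ (FreeGroup X)) ∉ augPow X d := by
        by_contra! hd
        have := eq_one_of_forall_mem_augPow hd
        exact hg (inv_mul_eq_one.1 this).symm
      obtain ⟨d, hd⟩ := this
      refine ⟨max c d, fun f hf hfc => ?_⟩
      rcases Finset.mem_insert.1 hf with rfl | hf
      · refine absurd ?_ hd
        exact inv_mul_mem_dimSubgroup.2 (augPow_antitone (le_max_right c d) hfc)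
      · exact hc f hf (augPow_antitone (le_max_left c d) hfc)

open scoped Pointwise in
lemma slowGrowth_of_toNil {Γ : Type*} [Group Γ] [DecidableEq Γ] {c : ℕ} (p : NilQuot X c →* Γ)
    (hp : Function.Surjective p) :
    SlowGrowth ((unitBall X).image (p.comp (toNil c))) where
  one_mem := Finset.mem_image.2 ⟨1, one_mem_unitBall, map_one _⟩
  exists_mem_pow g := by
    obtain ⟨f, rfl⟩ := (hp.comp (toNil_surjective c)) g
    obtain ⟨r, hr⟩ := exists_mem_unitBall_pow f
    refine ⟨r, ?_⟩
    rw [← Finset.image_pow]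
    exact Finset.mem_image_of_mem _ hr
  exists_lt {n m} s hnm := by
    classical
    obtain ⟨W, hW⟩ := card_image_toNil_le (X := X) c
    refine exists_slow_step (a := fun r => (((unitBall X).image (p.comp (toNil c))) ^ r).card)
      (fun r => ?_) (c := c) (W := W) (fun r hr => ?_) hnm s
    · rw [Finset.card_pos]
      exact Finset.Nonempty.pow ⟨1, Finset.mem_image.2 ⟨1, one_mem_unitBall, map_one _⟩⟩
    · refine le_trans ?_ (hW r hr)
      rw [← Finset.image_pow]
      have : (unitBall X ^ r).image (p.comp (toNil c)) =
          ((unitBall X ^ r).image (toNil c)).image p := by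
        rw [Finset.image_image]
        rfl
      rw [this]
      exact Finset.card_image_le

theorem card_le_of_idempotent_mod_six {ψ : FreeGroup X →* FreeGroup X}
    (h6 : ∀ j, ∃ u ∈ augPow X 1, (single (ψ (ψ (.of j))) 1 - single (ψ (.of j)) 1 - (6 : ℤ) • u :
      MonoidAlgebra ℤ (FreeGroup X)) ∈ augPow X 2)
    {H : Subgroup (FreeGroup X)} (hH : ∀ f, f ∈ H ↔ ψ f = f)
    {Y : Type*} (e : FreeGroup Y ≃* H) {m : ℕ} {y : Fin m → Y} (hy : Function.Injective y) :
    m ≤ Fintype.card X := by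
  have := Fintype.toEncodable X
  obtain ⟨r, hr1, hr, hrm⟩ := exists_coset_representatives H
  let T : Finset (FreeGroup X) := Finset.univ.biUnion fun p : Fin m × X =>
    (fox ℚ p.2 (e (.of (y p.1))).1).coeff.support.image r
  have hT : ∀ i j f, (fox ℚ j (e (.of (y i))).1).coeff f ≠ 0 → r f ∈ T := fun i j f hf =>
    Finset.mem_biUnion.2 ⟨(i, j), Finset.mem_univ _,
      Finset.mem_image_of_mem _ (Finsupp.mem_support_iff.2 hf)⟩
  have hrr : ∀ τ ∈ T, r τ = τ := by
    intro τ hτ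
    obtain ⟨p, _, hp⟩ := Finset.mem_biUnion.1 hτ
    obtain ⟨f, _, rfl⟩ := Finset.mem_image.1 hp
    have := hr _ (inv_mem (hrm f)) f
    rwa [mul_inv_rev, inv_inv, inv_mul_cancel_right] at this
  obtain ⟨c, hc⟩ := exists_separating_degree ψ ((T ×ˢ T).image fun p => p.1 * p.2⁻¹)
  obtain ⟨i₀, hi₀⟩ := exists_nilMap_stable c ψ
  set s := nilMap c ψ with hs
  let Γ := (endPow s i₀).range
  have : MulLeftStrictMono Γ := ⟨fun x y z h => mul_lt_mul_right (α := NilQuot X c) h x.1⟩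
  have : MulRightStrictMono Γ := ⟨fun x y z h => mul_lt_mul_left (α := NilQuot X c) h x.1⟩
  have : MulRightMono Γ := mulRightMono_of_mulRightStrictMono _
  have : MulLeftMono Γ := mulLeftMono_of_mulLeftStrictMono _
  have comm : ∀ x, s (endPow s i₀ x) = endPow s i₀ (s x) := fun x => by
    rw [← endPow_succ_apply, endPow_succ]
  let σ : Γ →* Γ := (s.comp Γ.subtype).codRestrict Γ (by
    rintro ⟨_, x, rfl⟩
    exact ⟨s x, (comm x).symm⟩)
  have hσs : ∀ z, (σ z : NilQuot X c) = s z := fun z => rfl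
  have hσ : Function.Injective σ := by
    rw [injective_iff_map_eq_one]
    rintro ⟨_, x, rfl⟩ hx
    have h1 : s (endPow s i₀ x) = 1 := congrArg Subtype.val hx
    rw [← endPow_succ_apply] at h1
    exact Subtype.ext (hi₀ x h1)
  have hσk : ∀ n z, (endPow σ n z : NilQuot X c) = endPow s n z := by
    intro n
    induction n with
    | zero => exact fun _ => rfl
    | succ n ih => exact fun z => by rw [endPow_succ, ih, endPow_succ, hσs]
  refine card_le_of_slowGrowth ℚ ψ (H := H) (fun h hh => (hH h).1 hh) hr1 hr hrm e hy hT
    (θ := toNil c) (q := (endPow s i₀).rangeRestrict.comp (toNil c)) (ι := Γ.subtype)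
    (fun _ _ h => h) (σ := σ) hσ (fun f => ?_) (i₀ := i₀) (fun f => ?_) (fun n hn g hg => ?_)
    (fun τ hτ τ' hτ' z z' hz hz' he => ?_)
    (slowGrowth_of_toNil _ (MonoidHom.rangeRestrict_surjective _))
  · refine Subtype.ext ?_
    change s (endPow s i₀ (toNil c f)) = endPow s i₀ (toNil c (ψ f))
    rw [comm]
    rfl
  · exact nilMap_pow_toNil c ψ i₀ f
  · refine Subtype.ext ?_
    exact nilMap_eq_self_of_periodic h6 hn ((hσk n g).symm.trans (congrArg Subtype.val hg))
  · have h1 : toNil c (τ * τ'⁻¹) = (z⁻¹ * z' : Γ) := by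
      rw [map_mul, map_inv, mul_inv_eq_iff_eq_mul]
      have : (z : NilQuot X c) * toNil c τ = z' * toNil c τ' := he
      push_cast
      rw [mul_assoc, ← this, inv_mul_cancel_left]
    have h2 : toNil c (ψ (τ * τ'⁻¹)) = toNil c (τ * τ'⁻¹) := by
      rw [← nilMap_toNil, h1, ← hs, ← hσs, map_mul, map_inv, hz, hz']
    have h3 : τ * τ'⁻¹ ∈ H := (hH _).2 (hc _
      (Finset.mem_image.2 ⟨(τ, τ'), Finset.mem_product.2 ⟨hτ, hτ'⟩, rfl⟩)
      (toNil_eq_iff.1 h2.symm))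
    have h4 := hr _ h3 τ'
    rwa [inv_mul_cancel_right, hrr τ hτ, hrr τ' hτ'] at h4

end FixedBound

section ShiftAlgebra

variable {k F : Type*} [CommRing k] [Group F] {p : ℕ}

/-- The cyclic shifts of tuples. -/
def shiftHom (F : Type*) [Group F] {p : ℕ} (i : ZMod p) : (ZMod p → F) →* (ZMod p → F) where
  toFun v j := v (j + i)
  map_one' := rfl
  map_mul' _ _ := rfl

/-- Replacing the coordinates in `T` by `1`. -/
def eraseHom (F : Type*) [Group F] {p : ℕ} (T : Finset (ZMod p)) :
    (ZMod p → F) →* (ZMod p → F) where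
  toFun v j := if j ∈ T then 1 else v j
  map_one' := by ext j; simp
  map_mul' v w := by
    ext j
    by_cases h : j ∈ T <;> simp [h]

lemma shiftHom_apply (i : ZMod p) (v : ZMod p → F) (j : ZMod p) :
    shiftHom F i v j = v (j + i) := rfl

lemma eraseHom_apply (T : Finset (ZMod p)) (v : ZMod p → F) (j : ZMod p) :
    eraseHom F T v j = if j ∈ T then 1 else v j := rfl

lemma gmap_shift_shift (i j : ZMod p) (w : MonoidAlgebra k (ZMod p → F)) :
    gmap k (shiftHom F i) (gmap k (shiftHom F j) w) = gmap k (shiftHom F (i + j)) w := by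
  rw [gmap_gmap]
  congr 2
  ext v l
  simp [shiftHom_apply, add_assoc]

lemma gmap_shift_zero (w : MonoidAlgebra k (ZMod p → F)) : gmap k (shiftHom F 0) w = w := by
  have : shiftHom F (0 : ZMod p) = MonoidHom.id _ := by
    ext v l
    simp [shiftHom_apply]
  rw [this]
  induction w using MonoidAlgebra.induction_linear with
  | zero => simp
  | add a b h h' => simp only [map_add, h, h']
  | single f r => simp

lemma gmap_erase_erase (S T : Finset (ZMod p)) (w : MonoidAlgebra k (ZMod p → F)) :
    gmap k (eraseHom F S) (gmap k (eraseHom F T) w) = gmap k (eraseHom F (S ∪ T)) w := by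
  rw [gmap_gmap]
  congr 2
  ext v l
  by_cases h : l ∈ S <;> simp [eraseHom_apply, h]

lemma gmap_erase_shift (T : Finset (ZMod p)) (i : ZMod p) (w : MonoidAlgebra k (ZMod p → F)) :
    gmap k (eraseHom F T) (gmap k (shiftHom F i) w) =
      gmap k (shiftHom F i) (gmap k (eraseHom F (T.map (addRightEmbedding i))) w) := by
  rw [gmap_gmap, gmap_gmap]
  congr 2
  ext v l
  simp [eraseHom_apply, shiftHom_apply]

/-- The filtration of the group algebra of `F ^ p` by the number of coordinates which have to be
erased in order to annihilate an element. -/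
noncomputable def filt (k F : Type*) [CommRing k] [Group F] (p r : ℕ) :
    Submodule k (MonoidAlgebra k (ZMod p → F)) :=
  ⨅ (T : Finset (ZMod p)) (_ : p < T.card + r), LinearMap.ker (gmap k (eraseHom F T)).toLinearMap

lemma mem_filt {r : ℕ} {w : MonoidAlgebra k (ZMod p → F)} :
    w ∈ filt k F p r ↔ ∀ T : Finset (ZMod p), p < T.card + r → gmap k (eraseHom F T) w = 0 := by
  simp [filt]

lemma mul_mem_filt {r : ℕ} (u : MonoidAlgebra k (ZMod p → F)) {w} (hw : w ∈ filt k F p r) :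
    u * w ∈ filt k F p r := by
  rw [mem_filt] at hw ⊢
  intro T hT
  rw [map_mul, hw T hT, mul_zero]

lemma gmap_shift_mem_filt {r : ℕ} (i : ZMod p) {w} (hw : w ∈ filt k F p r) :
    gmap k (shiftHom F i) w ∈ filt k F p r := by
  rw [mem_filt] at hw ⊢
  intro T hT
  rw [gmap_erase_shift, hw _ (by simpa using hT), map_zero]

/-- The part of an element which involves the coordinate `i`. -/
noncomputable def coordPart (i : ZMod p) :
    MonoidAlgebra k (ZMod p → F) →ₗ[k] MonoidAlgebra k (ZMod p → F) :=
  LinearMap.id - (gmap k (eraseHom F {i})).toLinearMap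

lemma coordPart_apply (i : ZMod p) (w : MonoidAlgebra k (ZMod p → F)) :
    coordPart i w = w - gmap k (eraseHom F {i}) w := rfl

lemma coordPart_shift (i : ZMod p) (w : MonoidAlgebra k (ZMod p → F)) :
    coordPart 0 (gmap k (shiftHom F i) w) = gmap k (shiftHom F i) (coordPart i w) := by
  rw [coordPart_apply, coordPart_apply, map_sub, gmap_erase_shift]
  congr 4
  simp

lemma coordPart_mul_sub_mem {r : ℕ} (i : ZMod p) (u : MonoidAlgebra k (ZMod p → F)) {w}
    (hw : w ∈ filt k F p r) : coordPart i (u * w) - u * coordPart i w ∈ filt k F p (r + 1) := by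
  have : coordPart i (u * w) - u * coordPart i w =
      (u - gmap k (eraseHom F {i}) u) * gmap k (eraseHom F {i}) w := by
    rw [coordPart_apply, coordPart_apply, map_mul]
    noncomm_ring
  rw [this]
  rw [mem_filt] at hw ⊢
  intro T hT
  rw [map_mul, map_sub, gmap_erase_erase, gmap_erase_erase]
  by_cases hi : i ∈ T
  · rw [Finset.union_eq_left.2 (by simpa using hi), sub_self, zero_mul]
  · rw [hw _ (by rw [Finset.card_union_of_disjoint (by simpa using hi)]; simp; omega), mul_zero]

lemma sum_coordPart_sub_mem [NeZero p] {r : ℕ} {w} (hw : w ∈ filt k F p r) :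
    ∑ i, coordPart i w - (r : k) • w ∈ filt k F p (r + 1) := by
  rw [mem_filt] at hw ⊢
  intro T hT
  have h1 : ∀ i, gmap k (eraseHom F T) (coordPart i w) =
      if i ∈ Tᶜ then gmap k (eraseHom F T) w else 0 := by
    intro i
    rw [coordPart_apply, map_sub, gmap_erase_erase]
    by_cases hi : i ∈ T
    · rw [Finset.union_eq_left.2 (by simpa using hi), sub_self, if_neg (by simpa using hi)]
    · rw [hw (T ∪ {i}) (by rw [Finset.card_union_of_disjoint (by simpa using hi)]; simp; omega),
        sub_zero, if_pos (by simpa using hi)]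
  rw [map_sub, map_sum, map_smul, Finset.sum_congr rfl fun i _ => h1 i, Finset.sum_ite_mem,
    Finset.univ_inter, Finset.sum_const, Finset.card_compl, ZMod.card]
  by_cases h2 : p < T.card + r
  · simp [hw T h2]
  · rw [show p - T.card = r by omega, Nat.cast_smul_eq_nsmul, sub_self]

lemma aug_eq_zero_iff_mem_filt_one [NeZero p] {w : MonoidAlgebra k (ZMod p → F)} :
    w ∈ filt k F p 1 ↔ aug k _ w = 0 := by
  have h1 : ∀ w : MonoidAlgebra k (ZMod p → F),
      gmap k (eraseHom F Finset.univ) w = single 1 (aug k _ w) := by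
    intro w
    induction w using MonoidAlgebra.induction_linear with
    | zero => simp
    | add a b h h' => simp only [map_add, h, h', single_add]
    | single f r =>
      rw [gmap_single, aug_single]
      congr 1
      ext j
      simp [eraseHom_apply]
  rw [mem_filt]
  constructor
  · intro h
    have := h Finset.univ (by simp [ZMod.card])
    rw [h1] at this
    simpa using this
  · intro h T hT
    have : T = Finset.univ := by
      rw [← Finset.card_eq_iff_eq_univ, ZMod.card]
      have := Finset.card_le_univ T
      rw [ZMod.card] at this
      omega
    rw [this, h1, h, single_zero]

/-- Sums of invariant functions over the cyclic shifts reduce to the constant tuples in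
characteristic `p`. -/
lemma sum_eq_zero_of_shift_invariant [Fact p.Prime] {A : Type*} [DecidableEq A]
    (f : Equiv.Perm A) (hf : f ^ p = 1)
    (S : Finset A) (hS : ∀ v, f v ∈ S ↔ v ∈ S) (hfix : ∀ v ∈ S, f v ≠ v) (φ : A → ZMod p)
    (hφ : ∀ v, φ (f v) = φ v) : ∑ v ∈ S, φ v = 0 := by
  rw [← Finset.sum_fiberwise S φ φ]
  refine Finset.sum_eq_zero fun c _ => ?_
  rw [Finset.sum_congr rfl fun v hv => (Finset.mem_filter.1 hv).2, Finset.sum_const,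
    nsmul_eq_mul]
  have hS' : ∀ v, v ∈ S.filter (fun v => φ v = c) ↔ f v ∈ S.filter (fun v => φ v = c) := by
    intro v
    rw [Finset.mem_filter, Finset.mem_filter, hS, hφ]
  let g : Equiv.Perm {v // v ∈ S.filter (fun v => φ v = c)} := f.subtypePerm fun v => (hS' v).symm
  have hg : g ^ p ^ 1 = 1 := by
    ext v
    rw [pow_one]
    simp [g, Equiv.Perm.subtypePerm_pow, hf]
  have h1 := (Equiv.Perm.card_compl_support_modEq hg).symm
  have h2 : g.supportᶜ = ∅ := by
    refine Finset.eq_empty_of_forall_notMem fun v hv => ?_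
    rw [Finset.mem_compl, Equiv.Perm.notMem_support] at hv
    have h3 : f v.1 = v.1 := congrArg Subtype.val hv
    exact hfix _ (Finset.mem_filter.1 v.2).1 h3
  rw [h2, Fintype.card_coe, Finset.card_empty] at h1
  have h3 : ((S.filter (fun v => φ v = c)).card : ZMod p) = 0 := by
    rw [ZMod.natCast_eq_zero_iff]
    exact (Nat.modEq_zero_iff_dvd).1 h1
  rw [h3, zero_mul]

end ShiftAlgebra

section RightFox

variable (k : Type*) [CommRing k] {X G : Type*} [Group G] [DecidableEq X]

/-- The action of the free group on a group algebra by inverse right multiplication. -/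
noncomputable def rightAction (d : FreeGroup X →* G) :
    FreeGroup X →* (MonoidAlgebra k G)ᵐᵒᵖ where
  toFun f := .op (single (d f⁻¹) 1)
  map_one' := by simp [← one_def]
  map_mul' f g := by
    rw [← MulOpposite.op_mul, single_mul_single]
    simp

/-- The derivation attached to the expansion of `1 - f⁻¹`. -/
noncomputable def invFox (d : FreeGroup X →* G) (j : X) (f : FreeGroup X) : MonoidAlgebra k G :=
  crossed (rightAction k d) (fun l => if l = j then single (d (.of l)⁻¹) 1 else 0) f

/-- The right Fox derivatives, with values in the group algebra of `G`. -/
noncomputable def rightFox (d : FreeGroup X →* G) (j : X) (f : FreeGroup X) : MonoidAlgebra k G :=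
  invFox k d j f * single (d f) 1

variable {k}

lemma invFox_of (d : FreeGroup X →* G) (j l : X) :
    invFox k d j (.of l) = if l = j then single (d (.of l)⁻¹) 1 else 0 := crossed_of ..

lemma invFox_mul (d : FreeGroup X →* G) (j : X) (f g : FreeGroup X) :
    invFox k d j (f * g) = invFox k d j f + invFox k d j g * single (d f⁻¹) 1 :=
  crossed_mul ..

lemma aug_rightFox (d : FreeGroup X →* G) (j : X) (f : FreeGroup X) :
    aug k G (rightFox k d j f) = aug k _ (fox k j f) := by
  rw [rightFox, map_mul, aug_single, mul_one]
  refine congrFun (crossed_unique (1 : FreeGroup X →* k) (D := fun f => aug k G (invFox k d j f))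
    (E := fun f => aug k _ (fox k j f)) ?_ ?_ ?_) f
  · intro f g
    simp [invFox_mul]
  · intro f g
    simp [fox_mul]
  · intro l
    rw [invFox_of, fox_of]
    split_ifs <;> simp

variable [Fintype X]

variable (k) in
/-- Combinations of the elements `d x - 1` with coefficients on the right. -/
noncomputable def comb (d : FreeGroup X →* G) :
    (X → MonoidAlgebra k G) →ₗ[k] MonoidAlgebra k G where
  toFun y := ∑ j, (single (d (.of j)) 1 - 1) * y j
  map_add' y z := by simp [mul_add, Finset.sum_add_distrib]
  map_smul' c y := by simp [Finset.smul_sum]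

lemma comb_apply (d : FreeGroup X →* G) (y : X → MonoidAlgebra k G) :
    comb k d y = ∑ j, (single (d (.of j)) 1 - 1) * y j := rfl

lemma single_sub_one_eq_comb (d : FreeGroup X →* G) (f : FreeGroup X) :
    single (d f) 1 - 1 = comb k d fun j => rightFox k d j f := by
  have h := congrFun (crossed_unique (rightAction k d)
    (D := fun f => (1 - single (d f⁻¹) 1 : MonoidAlgebra k G))
    (E := fun f => ∑ j, (single (d (.of j)) 1 - 1) * invFox k d j f) ?_ ?_ ?_) f
  · simp only [comb_apply, rightFox, ← mul_assoc]
    rw [← Finset.sum_mul, ← h, sub_mul, one_mul, single_mul_single, ← map_mul, inv_mul_cancel,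
      map_one, mul_one, one_def]
  · intro f g
    change _ = _ + _ * single (d f⁻¹) 1
    rw [sub_mul, single_mul_single, one_mul, mul_inv_rev, map_mul, mul_one]
    abel
  · intro f g
    change _ = _ + _ * single (d f⁻¹) 1
    simp only [invFox_mul, mul_add, Finset.sum_add_distrib, Finset.sum_mul, mul_assoc]
  · intro l
    simp only [invFox_of, mul_ite, mul_zero, Finset.sum_ite_eq, Finset.mem_univ, if_true]
    rw [sub_mul, single_mul_single, ← map_mul]
    simp [one_def]

lemma comb_injective {d : FreeGroup X →* G} {ε : G →* FreeGroup X} (hε : ∀ f, ε (d f) = f) :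
    Function.Injective (comb k d) := by
  let D : X → MonoidAlgebra k G →ₗ[k] MonoidAlgebra k G := fun j =>
    linExt fun v => invFox k d j (ε v) * single v 1
  have h1 : ∀ j l w, D j ((single (d (.of l)) 1 - 1) * w) = if l = j then w else 0 := by
    intro j l w
    induction w using MonoidAlgebra.induction_linear with
    | zero => simp
    | add a b h h' =>
      rw [mul_add, map_add, h, h']
      split_ifs <;> simp
    | single v r =>
      rw [sub_mul, one_mul, single_mul_single, one_mul, map_sub, linExt_single, linExt_single,
        map_mul, hε, invFox_mul, add_mul, mul_assoc, single_mul_single, ← mul_assoc, ← map_mul,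
        inv_mul_cancel, map_one, one_mul, one_mul, smul_add, add_sub_cancel_right, invFox_of]
      split_ifs
      · rw [single_mul_single, ← mul_assoc, ← map_mul, inv_mul_cancel]
        simp
      · simp
  have h2 : ∀ y j, D j (comb k d y) = y j := by
    intro y j
    rw [comb_apply, map_sum, Finset.sum_congr rfl fun l _ => h1 j l (y l)]
    simp
  intro y z h
  funext j
  rw [← h2 y, h, h2]

end RightFox

section Diagonal

variable {X : Type*} {p : ℕ} [NeZero p]

/-- The orbit map of an endomorphism of order `p`. -/
def diagHom {F : Type*} [Group F] (p : ℕ) (σ : F →* F) : F →* (ZMod p → F) where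
  toFun f i := endPow σ i.val f
  map_one' := by ext; simp
  map_mul' f g := by ext; simp

lemma diagHom_apply {F : Type*} [Group F] (σ : F →* F) (f : F) (i : ZMod p) :
    diagHom p σ f i = endPow σ i.val f := rfl

lemma diagHom_zero {F : Type*} [Group F] (σ : F →* F) (f : F) :
    diagHom p σ f 0 = f := by
  rw [diagHom_apply, ZMod.val_zero, endPow_zero]

lemma endPow_mod {F : Type*} [Group F] {σ : F →* F} (hσ : ∀ f, endPow σ p f = f) (a : ℕ) (f : F) :
    endPow σ (a % p) f = endPow σ a f := by
  conv_rhs => rw [← Nat.mod_add_div a p, endPow_add, endPow_mul, endPow_eq_self (hσ f)]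

lemma shiftHom_diagHom {F : Type*} [Group F] {σ : F →* F} (hσ : ∀ f, endPow σ p f = f)
    (i : ZMod p) (f : F) : shiftHom F i (diagHom p σ f) = diagHom p σ (endPow σ i.val f) := by
  ext j
  rw [shiftHom_apply, diagHom_apply, diagHom_apply, ZMod.val_add, endPow_mod hσ, endPow_add]

lemma diagHom_of_fixed {F : Type*} [Group F] {σ : F →* F} {f : F} (hf : σ f = f) :
    diagHom p σ f = fun _ => f := by
  ext j
  rw [diagHom_apply, endPow_eq_self hf]

end Diagonal

section CombFilt

variable {X : Type*} [DecidableEq X] [Fintype X] {p : ℕ} [NeZero p] {k : Type*} [CommRing k]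
  {σ : FreeGroup X →* FreeGroup X}

lemma gmap_shift_comb (hσ : ∀ f, endPow σ p f = f) (i : ZMod p)
    (y : X → MonoidAlgebra k (ZMod p → FreeGroup X)) :
    gmap k (shiftHom _ i) (comb k (diagHom p σ) y) = comb k (diagHom p σ) fun l =>
      ∑ j, rightFox k (diagHom p σ) l (endPow σ i.val (.of j)) * gmap k (shiftHom _ i) (y j) := by
  simp only [comb_apply, map_sum, map_mul, map_sub, gmap_single, map_one, shiftHom_diagHom hσ,
    Finset.mul_sum]
  rw [Finset.sum_comm]
  refine Finset.sum_congr rfl fun j _ => ?_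
  rw [single_sub_one_eq_comb, comb_apply, Finset.sum_mul]
  exact Finset.sum_congr rfl fun l _ => mul_assoc ..

variable (k) in
/-- Combinations with coefficients in the filtration of the group algebra. -/
noncomputable def combFilt (σ : FreeGroup X →* FreeGroup X) (p r : ℕ) :
    Submodule k (MonoidAlgebra k (ZMod p → FreeGroup X)) :=
  (Submodule.pi Set.univ fun _ : X => filt k (FreeGroup X) p r).map (comb k (diagHom p σ))

lemma mem_combFilt {r : ℕ} {w : MonoidAlgebra k (ZMod p → FreeGroup X)} :
    w ∈ combFilt k σ p r ↔
      ∃ y, (∀ j, y j ∈ filt k (FreeGroup X) p r) ∧ comb k (diagHom p σ) y = w := by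
  simp [combFilt, Submodule.mem_map, Submodule.mem_pi]

lemma gmap_shift_mem_combFilt (hσ : ∀ f, endPow σ p f = f) {r : ℕ} (i : ZMod p)
    {w : MonoidAlgebra k (ZMod p → FreeGroup X)} (hw : w ∈ combFilt k σ p r) :
    gmap k (shiftHom _ i) w ∈ combFilt k σ p r := by
  obtain ⟨y, hy, rfl⟩ := mem_combFilt.1 hw
  refine mem_combFilt.2 ⟨_, fun l => ?_, (gmap_shift_comb hσ i y).symm⟩
  exact Submodule.sum_mem _ fun j _ => mul_mem_filt _ (gmap_shift_mem_filt i (hy j))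

lemma comb_coordPart_sub_mem (hσ : ∀ f, endPow σ p f = f) {r : ℕ}
    {y : X → MonoidAlgebra k (ZMod p → FreeGroup X)} (hy : ∀ j, y j ∈ filt k (FreeGroup X) p r)
    {i : ZMod p} (hi : gmap k (shiftHom _ i) (comb k (diagHom p σ) y) = comb k (diagHom p σ) y) :
    comb k (diagHom p σ) (fun l => coordPart 0 (y l)) -
      gmap k (shiftHom _ i) (comb k (diagHom p σ) fun l => coordPart i (y l)) ∈
        combFilt k σ p (r + 1) := by
  rw [gmap_shift_comb hσ] at hi
  have h1 := comb_injective (k := k) (ε := Pi.evalMonoidHom (fun _ : ZMod p => FreeGroup X) 0) (diagHom_zero (p := p) σ) hi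
  rw [gmap_shift_comb hσ, ← map_sub]
  refine mem_combFilt.2 ⟨_, fun l => ?_, rfl⟩
  rw [Pi.sub_apply, ← congrFun h1 l, map_sum, ← Finset.sum_sub_distrib]
  refine Submodule.sum_mem _ fun j _ => ?_
  rw [← coordPart_shift]
  exact coordPart_mul_sub_mem 0 _ (gmap_shift_mem_filt i (hy j))

lemma sum_gmap_shift_reindex (i : ZMod p) (w : MonoidAlgebra k (ZMod p → FreeGroup X)) :
    gmap k (shiftHom _ i) (∑ j, gmap k (shiftHom _ j) w) = ∑ j, gmap k (shiftHom _ j) w := by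
  simp only [map_sum, gmap_shift_shift]
  exact Fintype.sum_equiv (Equiv.addLeft i) _ _ fun j => rfl

end CombFilt

section Norm

variable {X : Type*} [DecidableEq X] [Fintype X] {p : ℕ} [Fact p.Prime]
  {σ : FreeGroup X →* FreeGroup X}

/-- Shift invariant elements are traces modulo the next step of the filtration. -/
lemma exists_sub_trace_mem_succ (hσ : ∀ f, endPow σ p f = f) {r : ℕ} (hr1 : 1 ≤ r) (hrp : r < p)
    {w : MonoidAlgebra (ZMod p) (ZMod p → FreeGroup X)} (hw : w ∈ combFilt (ZMod p) σ p r)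
    (hinv : ∀ i, gmap (ZMod p) (shiftHom _ i) w = w) :
    ∃ z, w - ∑ i, gmap (ZMod p) (shiftHom _ i) z ∈ combFilt (ZMod p) σ p (r + 1) := by
  obtain ⟨y, hy, rfl⟩ := mem_combFilt.1 hw
  have hr : (r : ZMod p) ≠ 0 := by
    rw [Ne, ZMod.natCast_eq_zero_iff]
    exact Nat.not_dvd_of_pos_of_lt hr1 hrp
  set C := comb (ZMod p) (diagHom p σ) with hC
  have h1 : ∀ i : ZMod p, gmap (ZMod p) (shiftHom _ (-i)) (C fun l => coordPart 0 (y l)) -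
      (C fun l => coordPart i (y l)) ∈ combFilt (ZMod p) σ p (r + 1) := by
    intro i
    have := gmap_shift_mem_combFilt hσ (-i) (comb_coordPart_sub_mem hσ hy (hinv i))
    rwa [map_sub, gmap_shift_shift, neg_add_cancel, gmap_shift_zero] at this
  have h2 := Submodule.sum_mem _ fun i (_ : i ∈ Finset.univ) => h1 i
  rw [Finset.sum_sub_distrib, Fintype.sum_equiv (Equiv.neg (ZMod p))
    (fun i => gmap (ZMod p) (shiftHom _ (-i)) (C fun l => coordPart 0 (y l)))
    (fun i => gmap (ZMod p) (shiftHom _ i) (C fun l => coordPart 0 (y l))) (fun i => rfl)] at h2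
  have h3 : ∑ i : ZMod p, (C fun l => coordPart i (y l)) - (r : ZMod p) • C y ∈
      combFilt (ZMod p) σ p (r + 1) := by
    rw [← map_sum, ← map_smul, ← map_sub]
    refine mem_combFilt.2 ⟨_, fun l => ?_, rfl⟩
    rw [Pi.sub_apply, Finset.sum_apply]
    exact sum_coordPart_sub_mem (hy l)
  refine ⟨(r : ZMod p)⁻¹ • (C fun l => coordPart 0 (y l)), ?_⟩
  have h4 := Submodule.smul_mem _ (-(r : ZMod p)⁻¹) (add_mem h2 h3)
  convert h4 using 1
  simp only [map_smul, ← Finset.smul_sum]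
  rw [sub_add_sub_cancel, smul_sub, neg_smul, neg_smul, smul_smul, inv_mul_cancel₀ hr, one_smul]
  abel

lemma exists_sub_trace_mem (hσ : ∀ f, endPow σ p f = f)
    {w : MonoidAlgebra (ZMod p) (ZMod p → FreeGroup X)} (hw : w ∈ combFilt (ZMod p) σ p 1)
    (hinv : ∀ i, gmap (ZMod p) (shiftHom _ i) w = w) :
    ∃ z, w - ∑ i, gmap (ZMod p) (shiftHom _ i) z ∈ combFilt (ZMod p) σ p p := by
  have : ∀ r, 1 ≤ r → r ≤ p →
      ∃ z, w - ∑ i, gmap (ZMod p) (shiftHom _ i) z ∈ combFilt (ZMod p) σ p r := by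
    intro r hr
    induction r, hr using Nat.le_induction with
    | base => exact fun _ => ⟨0, by simpa using hw⟩
    | succ r hr ih =>
      intro hrp
      obtain ⟨z, hz⟩ := ih (by omega)
      obtain ⟨z', hz'⟩ := exists_sub_trace_mem_succ hσ hr hrp hz fun i => by
        rw [map_sub, hinv, sum_gmap_shift_reindex]
      refine ⟨z + z', ?_⟩
      simpa only [map_add, Finset.sum_add_distrib, sub_sub] using hz'
  exact this p (Fact.out : p.Prime).one_le le_rfl

end Norm

section ConstPart

variable {F : Type*} [Group F] {p : ℕ} [Fact p.Prime]

open Classical in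
/-- The part of an element supported on constant tuples. -/
noncomputable def constPart :
    MonoidAlgebra (ZMod p) (ZMod p → F) →ₗ[ZMod p] MonoidAlgebra (ZMod p) F :=
  linExt fun v => if v = fun _ => v 0 then single (v 0) 1 else 0

lemma coeff_constPart (w : MonoidAlgebra (ZMod p) (ZMod p → F)) (f : F) :
    (constPart w).coeff f = w.coeff fun _ => f := by
  classical
  induction w using MonoidAlgebra.induction_linear with
  | zero => simp
  | add a b h h' => simp [h, h']
  | single v r =>
    rw [constPart, linExt_single, coeff_single, Finsupp.single_apply]
    by_cases hv : v = fun _ => v 0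
    · rw [if_pos hv]
      by_cases hf : v 0 = f
      · rw [if_pos (hv.trans (by rw [hf])), ← hf]
        simp
      · rw [if_neg fun h => hf (congrFun h 0)]
        simp [Finsupp.single_apply, hf]
    · rw [if_neg hv, if_neg, smul_zero]
      · rfl
      · rintro rfl
        exact hv rfl

lemma constPart_shift (i : ZMod p) (w : MonoidAlgebra (ZMod p) (ZMod p → F)) :
    constPart (gmap _ (shiftHom F i) w) = constPart w := by
  classical
  induction w using MonoidAlgebra.induction_linear with
  | zero => simp
  | add a b h h' => simp only [map_add, h, h']
  | single v r =>
    rw [gmap_single, constPart, linExt_single, linExt_single]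
    congr 1
    by_cases hv : v = fun _ => v 0
    · rw [if_pos hv, hv]
      exact if_pos rfl
    · rw [if_neg hv, if_neg]
      intro h
      refine hv ?_
      have h1 : ∀ j, v j = v (0 + i) := fun j => by
        have := congrFun h (j - i)
        rwa [shiftHom_apply, sub_add_cancel] at this
      ext j
      rw [h1 j, h1 0]

lemma constPart_trace (w : MonoidAlgebra (ZMod p) (ZMod p → F)) :
    constPart (∑ i, gmap _ (shiftHom F i) w) = 0 := by
  rw [map_sum, Finset.sum_congr rfl fun i _ => constPart_shift i w, Finset.sum_const,
    Finset.card_univ, ZMod.card, ← Nat.cast_smul_eq_nsmul (ZMod p)]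
  simp

/-- The cyclic shift as a permutation. -/
def shiftPerm (F : Type*) [Group F] (p : ℕ) : Equiv.Perm (ZMod p → F) where
  toFun v := shiftHom F 1 v
  invFun v := shiftHom F (-1) v
  left_inv v := by ext; simp [shiftHom_apply]
  right_inv v := by ext; simp [shiftHom_apply]

lemma shiftPerm_pow_apply (n : ℕ) (v : ZMod p → F) (j : ZMod p) :
    (shiftPerm F p ^ n) v j = v (j + n) := by
  induction n generalizing v with
  | zero => simp
  | succ n ih =>
    rw [pow_succ, Equiv.Perm.mul_apply, ih]
    simp [shiftPerm, shiftHom_apply, add_assoc]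

/-- Shift invariant functions evaluated at shift invariant elements only depend on constant
tuples. -/
lemma linExt_eq_linExt_constPart {w : MonoidAlgebra (ZMod p) (ZMod p → F)}
    (hw : ∀ i, gmap _ (shiftHom F i) w = w) {φ : (ZMod p → F) → ZMod p}
    (hφ : ∀ i v, φ (shiftHom F i v) = φ v) :
    linExt φ w = linExt (fun f => φ fun _ => f) (constPart w) := by
  classical
  let χ : (ZMod p → F) → ZMod p := fun v => if v = fun _ => v 0 then φ v else 0
  have h1 : linExt (fun f => φ fun _ => f) ∘ₗ constPart = linExt (R := ZMod p) χ := by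
    refine algebra_hom_ext fun v => ?_
    rw [LinearMap.comp_apply, constPart, linExt_single, linExt_single]
    by_cases hv : v = fun _ => v 0
    · simp only [χ, if_pos hv, one_smul, linExt_single]
      exact congrArg φ hv.symm
    · simp only [χ, if_neg hv, smul_zero, map_zero]
  have h2 : ∀ v, w.coeff (shiftHom F 1 v) = w.coeff v := by
    intro v
    conv_lhs => rw [← hw 1]
    exact coeff_gmap (shiftPerm F p).injective w v
  have h3 : ∀ v : ZMod p → F, shiftHom F 1 v = v → v = fun _ => v 0 := by
    intro v hv
    have h4 : ∀ n : ℕ, v n = v 0 := by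
      intro n
      have h5 : (shiftPerm F p ^ n) v = v := by
        induction n with
        | zero => rfl
        | succ n ih =>
          rw [pow_succ, Equiv.Perm.mul_apply]
          exact (congrArg _ hv).trans ih
      have := congrFun h5 0
      rwa [shiftPerm_pow_apply, zero_add] at this
    funext j
    rw [← h4 j.val, ZMod.natCast_zmod_val]
  rw [← LinearMap.comp_apply, h1, ← sub_eq_zero, linExt_apply, linExt_apply, Finsupp.sum,
    Finsupp.sum, ← Finset.sum_sub_distrib,
    ← Finset.sum_filter_add_sum_filter_not _ (fun v : ZMod p → F => v = fun _ => v 0)]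
  rw [Finset.sum_eq_zero fun v hv => ?_, zero_add, Finset.sum_congr rfl fun v hv => ?_]
  · refine sum_eq_zero_of_shift_invariant (shiftPerm F p) ?_ _ (fun v => ?_) (fun v hv h => ?_)
      (fun v => w.coeff v • φ v) fun v => ?_
    · ext v j
      simp [shiftPerm_pow_apply]
    · rw [Finset.mem_filter, Finset.mem_filter, Finsupp.mem_support_iff, Finsupp.mem_support_iff]
      change w.coeff (shiftHom F 1 v) ≠ 0 ∧ _ ↔ _
      rw [h2]
      refine and_congr Iff.rfl (not_congr ⟨fun h => ?_, fun h => ?_⟩)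
      · have h4 : ∀ j, v (j + 1) = v (0 + 1) := fun j => congrFun h j
        funext j
        have h5 := h4 (j - 1)
        have h6 := h4 (-1)
        rw [sub_add_cancel] at h5
        rw [neg_add_cancel] at h6
        rw [h5, h6]
      · funext j
        change v (j + 1) = v (0 + 1)
        rw [h]
    · exact (Finset.mem_filter.1 hv).2 (h3 v h)
    · change w.coeff (shiftHom F 1 v) • φ (shiftHom F 1 v) = _
      rw [h2, hφ]
  · simp only [χ, if_neg (Finset.mem_filter.1 hv).2, smul_zero, sub_zero]
  · simp only [χ, if_pos (Finset.mem_filter.1 hv).2, sub_self]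

end ConstPart

section Tensor

variable {k F : Type*} [CommRing k] [Group F] {p : ℕ} [NeZero p]

/-- The external product of elements of a group algebra. -/
noncomputable def tens (a : ZMod p → MonoidAlgebra k F) : MonoidAlgebra k (ZMod p → F) :=
  .ofCoeff (Finsupp.onFinset (Fintype.piFinset fun i => (a i).coeff.support)
    (fun e => ∏ i, (a i).coeff (e i)) fun e he => Fintype.mem_piFinset.2 fun i =>
      Finsupp.mem_support_iff.2 fun h => he (Finset.prod_eq_zero (Finset.mem_univ i) h))

lemma coeff_tens (a : ZMod p → MonoidAlgebra k F) (e : ZMod p → F) :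
    (tens a).coeff e = ∏ i, (a i).coeff (e i) := rfl

lemma tens_add (a b : ZMod p → MonoidAlgebra k F) :
    tens (fun i => a i + b i) = ∑ T : Finset (ZMod p), tens (T.piecewise a b) := by
  ext e
  simp only [coeff_sum, Finsupp.finsetSum_apply, coeff_tens, coeff_add, Finsupp.add_apply]
  rw [Fintype.prod_add]
  refine Finset.sum_congr rfl fun T _ => ?_
  have : ∀ i, (T.piecewise a b i).coeff (e i) =
      T.piecewise (fun i => (a i).coeff (e i)) (fun i => (b i).coeff (e i)) i := by
    intro i
    by_cases h : i ∈ T <;> simp [h]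
  simp only [this]
  rw [Finset.prod_piecewise, Finset.univ_inter, Finset.compl_eq_univ_sdiff]

lemma tens_single_mul (u : ZMod p → F) (a : ZMod p → MonoidAlgebra k F) :
    tens (fun i => single (u i) 1 * a i) = single u 1 * tens a := by
  ext e
  simp [coeff_tens, coeff_single_mul_apply]

lemma tens_shift (j : ZMod p) (a : ZMod p → MonoidAlgebra k F) :
    tens (fun i => a (i + j)) = gmap k (shiftHom F j) (tens a) := by
  have hinj : Function.Injective (shiftHom F j) := fun v w h => by
    ext i
    have := congrFun h (i - j)
    rwa [shiftHom_apply, shiftHom_apply, sub_add_cancel] at this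
  ext e
  obtain ⟨e, rfl⟩ : ∃ e', shiftHom F j e' = e := ⟨shiftHom F (-j) e, by ext; simp [shiftHom_apply]⟩
  rw [coeff_gmap hinj, coeff_tens, coeff_tens]
  exact Fintype.prod_equiv (Equiv.addRight j) _ _ fun i => rfl

lemma coeff_linExt {G H : Type*} (N : G → MonoidAlgebra k H) (w : MonoidAlgebra k G) (h : H) :
    (linExt N w).coeff h = linExt (fun g => (N g).coeff h) w := by
  simp only [linExt_apply, Finsupp.sum, coeff_sum, Finsupp.finsetSum_apply]
  rfl

end Tensor

section FoxTensor

variable {k : Type*} [CommRing k] {X : Type*} [DecidableEq X] {p : ℕ} [NeZero p]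

/-- The tuplewise Fox derivative. -/
noncomputable def foxTens (j : X) (v : ZMod p → FreeGroup X) :
    MonoidAlgebra k (ZMod p → FreeGroup X) := tens fun i => fox k j (v i)

lemma linExt_foxTens_shift (j : X) (i : ZMod p) (w : MonoidAlgebra k (ZMod p → FreeGroup X)) :
    linExt (foxTens j) (gmap k (shiftHom _ i) w) =
      gmap k (shiftHom _ i) (linExt (foxTens j) w) := by
  induction w using MonoidAlgebra.induction_linear with
  | zero => simp
  | add a b h h' => simp only [map_add, h, h']
  | single v r =>
    rw [gmap_single, linExt_single, linExt_single, map_smul]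
    congr 1
    exact tens_shift i fun l => fox k j (v l)

lemma linExt_foxTens_single_mul (j : X) (u : ZMod p → FreeGroup X)
    {w : MonoidAlgebra k (ZMod p → FreeGroup X)} (hw : w ∈ filt k (FreeGroup X) p p) :
    linExt (R := k) (foxTens (k := k) j) (single u 1 * w) =
      single u 1 * linExt (R := k) (foxTens j) w := by
  let P : Finset (ZMod p) → (ZMod p → FreeGroup X) → MonoidAlgebra k (ZMod p → FreeGroup X) :=
    fun T v => tens (T.piecewise (fun i => fox k j (u i))
      fun i => single (u i) 1 * fox k j (v i))
  have h1 : ∀ w, linExt (R := k) (foxTens (k := k) j) (single u (1 : k) * w) = ∑ T, linExt (P T) w := by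
    intro w
    induction w using MonoidAlgebra.induction_linear with
    | zero => simp
    | add a b h h' => simp only [map_add, mul_add, h, h', Finset.sum_add_distrib]
    | single v r =>
      simp only [single_mul_single, linExt_single, one_mul, ← Finset.smul_sum, P]
      rw [← tens_add, foxTens]
      simp only [Pi.mul_apply, fox_mul]
  have h2 : ∀ w : MonoidAlgebra k (ZMod p → FreeGroup X),
      linExt (P ∅) w = single u 1 * linExt (foxTens j) w := by
    intro w
    induction w using MonoidAlgebra.induction_linear with
    | zero => simp
    | add a b h h' => simp only [map_add, mul_add, h, h']
    | single v r =>
      simp only [linExt_single, mul_smul_comm, P, Finset.piecewise_empty]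
      rw [foxTens, ← tens_single_mul]
  have h3 : ∀ T, T.Nonempty → linExt (P T) w = 0 := by
    intro T hT
    have h4 : linExt (R := k) (P T) = linExt (P T) ∘ₗ (gmap k (eraseHom _ T)).toLinearMap := by
      refine algebra_hom_ext fun v => ?_
      rw [LinearMap.comp_apply, AlgHom.toLinearMap_apply, gmap_single, linExt_single,
        linExt_single]
      refine congrArg (1 • tens ·) (funext fun i => ?_)
      by_cases hi : i ∈ T <;> simp [hi, eraseHom_apply]
    rw [h4, LinearMap.comp_apply, AlgHom.toLinearMap_apply, mem_filt.1 hw T (by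
      have := hT.card_pos
      omega), map_zero]
  rw [h1, ← h2]
  exact Finset.sum_eq_single _ (fun T _ hT => h3 T (Finset.nonempty_iff_ne_empty.2 hT)) (by simp)

end FoxTensor

section Periodic

variable {X : Type*} [DecidableEq X] [Fintype X] {p : ℕ} [Fact p.Prime]
  {σ : FreeGroup X →* FreeGroup X}

open Classical in
/-- The extension of a function to the tuples `d g * (f, …, f)`. -/
noncomputable def hatFun {k : Type*} [Zero k] (σ : FreeGroup X →* FreeGroup X)
    (φ : FreeGroup X → k) (e : ZMod p → FreeGroup X) : k :=
  if h : ∃ f g, e = diagHom p σ g * fun _ => f then φ h.choose else 0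

lemma hatFun_diagHom_mul_const {k : Type*} [Zero k] {φ : FreeGroup X → k}
    (hφ : ∀ h, σ h = h → ∀ f, φ (h * f) = φ f) (f g : FreeGroup X) :
    hatFun σ φ (diagHom p σ g * fun _ => f) = φ f := by
  have h : ∃ f' g', (diagHom p σ g * fun _ => f) = diagHom p σ g' * fun _ => f' := ⟨f, g, rfl⟩
  rw [hatFun, dif_pos h]
  obtain ⟨g', hg'⟩ := h.choose_spec
  set f' := h.choose
  have h0 := congrFun hg' 0
  have h1 := congrFun hg' 1
  have hp : (1 : ZMod p).val = 1 := ZMod.val_one'' (Fact.out : p.Prime).ne_one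
  simp only [Pi.mul_apply, diagHom_zero] at h0
  simp only [Pi.mul_apply, diagHom_apply, hp] at h1
  rw [endPow_succ, endPow_succ, endPow_zero, endPow_zero] at h1
  have h2 : f * f'⁻¹ = g⁻¹ * g' := by
    rw [mul_inv_eq_iff_eq_mul, mul_assoc, ← h0, inv_mul_cancel_left]
  have h3 : f * f'⁻¹ = (σ g)⁻¹ * σ g' := by
    rw [mul_inv_eq_iff_eq_mul, mul_assoc, ← h1, inv_mul_cancel_left]
  have h4 := hφ (f * f'⁻¹) (by
    nth_rewrite 1 [h2]
    rw [map_mul, map_inv, h3]) f'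
  rw [← h4, inv_mul_cancel_right]

lemma hatFun_diagHom_mul {k : Type*} [Zero k] {φ : FreeGroup X → k}
    (hφ : ∀ h, σ h = h → ∀ f, φ (h * f) = φ f) (g : FreeGroup X) (e : ZMod p → FreeGroup X) :
    hatFun σ φ (diagHom p σ g * e) = hatFun σ φ e := by
  by_cases h : ∃ f g, e = diagHom p σ g * fun _ => f
  · obtain ⟨f, g', rfl⟩ := h
    rw [← mul_assoc, ← map_mul, hatFun_diagHom_mul_const hφ, hatFun_diagHom_mul_const hφ]
  · have h' : ¬ ∃ f g', diagHom p σ g * e = diagHom p σ g' * fun _ => f := by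
      rintro ⟨f, g', h'⟩
      refine h ⟨f, g⁻¹ * g', ?_⟩
      rw [map_mul, mul_assoc, ← h', ← mul_assoc, ← map_mul, inv_mul_cancel, map_one, one_mul]
    rw [hatFun, hatFun, dif_neg h, dif_neg h']

lemma hatFun_shiftHom {k : Type*} [Zero k] {φ : FreeGroup X → k}
    (hφ : ∀ h, σ h = h → ∀ f, φ (h * f) = φ f) (hσ : ∀ f, endPow σ p f = f) (i : ZMod p)
    (e : ZMod p → FreeGroup X) : hatFun σ φ (shiftHom _ i e) = hatFun σ φ e := by
  have key : ∀ i f g, shiftHom _ i (diagHom p σ g * fun _ => f) =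
      diagHom p σ (endPow σ i.val g) * fun _ => f := by
    intro i f g
    rw [map_mul, shiftHom_diagHom hσ]
    rfl
  by_cases h : ∃ f g, e = diagHom p σ g * fun _ => f
  · obtain ⟨f, g, rfl⟩ := h
    rw [key, hatFun_diagHom_mul_const hφ, hatFun_diagHom_mul_const hφ]
  · have h' : ¬ ∃ f g, shiftHom _ i e = diagHom p σ g * fun _ => f := by
      rintro ⟨f, g, h'⟩
      refine h ⟨f, endPow σ (-i).val g, ?_⟩
      rw [← key, ← h']
      ext j
      simp [shiftHom_apply]
    rw [hatFun, hatFun, dif_neg h, dif_neg h']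

lemma constPart_single_const (f : FreeGroup X) (c : ZMod p) :
    constPart (single (fun _ : ZMod p => f) c) = single f c := by
  rw [constPart, linExt_single, if_pos rfl]
  simp

lemma constPart_foxTens (j : X) {w : MonoidAlgebra (ZMod p) (ZMod p → FreeGroup X)}
    (hw : ∀ i, gmap (ZMod p) (shiftHom _ i) w = w) :
    constPart (linExt (foxTens j) w) = dfox j (constPart w) := by
  ext f
  rw [coeff_constPart, coeff_linExt, dfox, coeff_linExt, linExt_eq_linExt_constPart hw]
  · congr 2
    ext g
    rw [foxTens, coeff_tens]
    simp [ZMod.card]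
  · intro i v
    rw [foxTens, foxTens, coeff_tens, coeff_tens]
    exact Fintype.prod_equiv (Equiv.addRight i) _ _ fun i => rfl

lemma sum_linExt_dfox {k A : Type*} [Field k] [AddCommGroup A] [Module k A] {Λ : FreeGroup X → A}
    (hΛ : Λ 1 = 0) (w : MonoidAlgebra k (FreeGroup X)) :
    ∑ j, linExt (fun f => Λ (f * .of j) - Λ f) (dfox j w) = linExt Λ w := by
  induction w using MonoidAlgebra.induction_linear with
  | zero => simp
  | add a b h h' => simp only [map_add, Finset.sum_add_distrib, h, h']
  | single f r =>
    simp only [dfox_single, map_smul, linExt_single]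
    rw [← Finset.smul_sum, ← linExt_sub_linExt_one, hΛ, sub_zero]

lemma linExt_constPart_eq_zero (hσ : ∀ f, endPow σ p f = f)
    {w : MonoidAlgebra (ZMod p) (ZMod p → FreeGroup X)} (hw : w ∈ combFilt (ZMod p) σ p p)
    (hinv : ∀ i, gmap (ZMod p) (shiftHom _ i) w = w) {Λ : FreeGroup X → ZMod p} (hΛ : Λ 1 = 0)
    (hΛH : ∀ h, σ h = h → ∀ f g, Λ (h * f * g) - Λ (h * f) = Λ (f * g) - Λ f) :
    linExt Λ (constPart w) = 0 := by
  let lam : X → FreeGroup X → ZMod p := fun j f => Λ (f * .of j) - Λ f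
  have hlam : ∀ j h, σ h = h → ∀ f, lam j (h * f) = lam j f := fun j h hh f => hΛH h hh f _
  have h1 : ∀ j, linExt (R := ZMod p) (hatFun σ (lam j)) (linExt (R := ZMod p) (foxTens j) w) =
      linExt (lam j) (dfox j (constPart w)) := by
    intro j
    rw [linExt_eq_linExt_constPart (fun i => ?_) fun i v => hatFun_shiftHom (hlam j) hσ i v,
      constPart_foxTens j hinv]
    · congr 2
      ext f
      have := hatFun_diagHom_mul_const (p := p) (hlam j) f 1
      rwa [map_one, one_mul] at this
    · rw [← linExt_foxTens_shift, hinv]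
  rw [← sum_linExt_dfox hΛ, ← Finset.sum_congr rfl fun j _ => h1 j]
  have h2 : ∀ (φ : FreeGroup X → ZMod p), (∀ h, σ h = h → ∀ f, φ (h * f) = φ f) → ∀ g
      (u : MonoidAlgebra (ZMod p) (ZMod p → FreeGroup X)),
      linExt (hatFun σ φ) (single (diagHom p σ g) 1 * u) = linExt (hatFun σ φ) u := by
    intro φ hφ g u
    induction u using MonoidAlgebra.induction_linear with
    | zero => simp
    | add a b h h' => simp only [mul_add, map_add, h, h']
    | single v r =>
      rw [single_mul_single, linExt_single, linExt_single, hatFun_diagHom_mul hφ, one_mul]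
  obtain ⟨y, hy, rfl⟩ := mem_combFilt.1 hw
  refine Finset.sum_eq_zero fun j _ => ?_
  simp only [comb_apply, map_sum]
  refine Finset.sum_eq_zero fun l _ => ?_
  rw [sub_mul, one_mul, map_sub, map_sub, linExt_foxTens_single_mul _ _ (hy l), h2 _ (hlam j),
    sub_self]

/-- A fixed subgroup of an automorphism of prime order has rank at most that of the group. -/
theorem card_le_of_endPow_prime (hσ : ∀ f, endPow σ p f = f) {H : Subgroup (FreeGroup X)}
    (hH : ∀ f, f ∈ H ↔ σ f = f) {Y : Type*} (e : FreeGroup Y ≃* H) {m : ℕ} {y : Fin m → Y}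
    (hy : Function.Injective y) : m ≤ Fintype.card X := by
  let h : Fin m → FreeGroup X := fun i => (e (.of (y i))).1
  have hh : ∀ i, σ (h i) = h i := fun i => (hH _).1 (e (.of (y i))).2
  suffices hlin : LinearIndependent (ZMod p)
      fun i => fun j => aug (ZMod p) _ (fox (ZMod p) j (h i)) by
    have := hlin.fintype_card_le_finrank
    simpa using this
  rw [Fintype.linearIndependent_iff]
  intro c hc l
  classical
  obtain ⟨r, hr1, hr, hrm⟩ := exists_coset_representatives H
  let α : FreeGroup Y → ZMod p :=
    crossed (1 : FreeGroup Y →* ZMod p) fun z => if z = y l then 1 else 0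
  have hα : ∀ f g, α (f * g) = α f + α g := fun f g => by
    simpa using crossed_mul (1 : FreeGroup Y →* ZMod p) (fun z => if z = y l then (1 : ZMod p) else 0) f g
  have hα1 : α 1 = 0 := crossed_one ..
  let Λ : FreeGroup X → ZMod p := fun f => α (e.symm ⟨f * (r f)⁻¹, hrm f⟩)
  have hΛmul : ∀ (g : H) f, Λ (g * f) = α (e.symm g) + Λ f := by
    intro g f
    rw [← hα, ← map_mul]
    refine congrArg (fun z => α (e.symm z)) (Subtype.ext ?_)
    change g * f * (r (g * f))⁻¹ = g * (f * (r f)⁻¹)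
    rw [hr g g.2, mul_assoc]
  have hΛ1 : Λ 1 = 0 := by
    have : (⟨1 * (r 1)⁻¹, hrm 1⟩ : H) = 1 := Subtype.ext (by simp [hr1])
    simp only [Λ, this, map_one, hα1]
  have hΛh : ∀ i, Λ (h i) = if i = l then 1 else 0 := by
    intro i
    have := hΛmul (e (.of (y i))) 1
    rw [mul_one, hΛ1, add_zero, e.symm_apply_apply] at this
    rw [show h i = (e (.of (y i))).1 from rfl, this]
    simp only [α, crossed_of, hy.eq_iff]
  let ξ : MonoidAlgebra (ZMod p) (ZMod p → FreeGroup X) :=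
    ∑ i, c i • (single (diagHom p σ (h i)) 1 - 1)
  have hξ : ξ ∈ combFilt (ZMod p) σ p 1 := by
    refine mem_combFilt.2 ⟨∑ i, c i • fun j => rightFox (ZMod p) (diagHom p σ) j (h i),
      fun j => ?_, ?_⟩
    · rw [aug_eq_zero_iff_mem_filt_one]
      simp only [Finset.sum_apply, Pi.smul_apply, map_sum, map_smul, aug_rightFox]
      simpa using congrFun hc j
    · simp only [ξ, map_sum, map_smul, single_sub_one_eq_comb]
  have hξinv : ∀ i, gmap (ZMod p) (shiftHom _ i) ξ = ξ := by
    intro i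
    simp only [ξ, map_sum, map_smul, map_sub, gmap_single, map_one, shiftHom_diagHom hσ,
      endPow_eq_self (hh _)]
  obtain ⟨z, hz⟩ := exists_sub_trace_mem hσ hξ hξinv
  have h1 := linExt_constPart_eq_zero hσ hz (fun i => by
    rw [map_sub, hξinv, sum_gmap_shift_reindex]) hΛ1 fun g hg f x => by
      have := hΛmul ⟨g, (hH g).2 hg⟩
      simp only at this
      rw [mul_assoc, this, this]
      abel
  rw [map_sub, constPart_trace, sub_zero] at h1
  have h2 : constPart ξ = ∑ i, c i • (single (h i) 1 - 1) := by
    simp only [ξ, map_sum, map_smul, map_sub]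
    refine Finset.sum_congr rfl fun i _ => ?_
    rw [diagHom_of_fixed (hh i), one_def, one_def, constPart_single_const,
      show (1 : ZMod p → FreeGroup X) = fun _ => 1 from rfl, constPart_single_const]
  rw [h2] at h1
  simpa [one_def, hΛh, hΛ1] using h1

end Periodic

section ModSix

variable {X : Type*} [DecidableEq X] [Fintype X]

/-- The exponent sums of an element modulo `6`. -/
noncomputable def expSum (f : FreeGroup X) (j : X) : ZMod 6 := (aug ℤ _ (fox ℤ j f) : ℤ)

lemma expSum_map (φ : FreeGroup X →* FreeGroup X) (f : FreeGroup X) (l : X) :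
    expSum (φ f) l = ∑ j, expSum f j * expSum (φ (.of j)) l := by
  simp [expSum, fox_map φ l f]

lemma exists_sub_sub_smul_mem_augPow {f g : FreeGroup X} (h : expSum f = expSum g) :
    ∃ u ∈ augPow X 1, (single f 1 - single g 1 - (6 : ℤ) • u : MonoidAlgebra ℤ (FreeGroup X)) ∈
      augPow X 2 := by
  have h1 : ∀ j, ∃ b : ℤ, aug ℤ _ (fox ℤ j f) - aug ℤ _ (fox ℤ j g) = 6 * b := by
    intro j
    have h2 : ((aug ℤ _ (fox ℤ j f) - aug ℤ _ (fox ℤ j g) : ℤ) : ZMod 6) = 0 := by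
      rw [Int.cast_sub, sub_eq_zero]
      exact congrFun h j
    exact (ZMod.intCast_zmod_eq_zero_iff_dvd _ 6).1 h2
  choose b hb using h1
  refine ⟨∑ l, b l • (single (.of l) 1 - 1), ?_, ?_⟩
  · rw [mem_augPow_one]
    simp
  · rw [mem_augPow_succ]
    refine ⟨by simp, fun j => ?_⟩
    rw [mem_augPow_one]
    simp only [map_sub, map_smul, map_sum, dfox_single, dfox_one, one_smul, fox_of, hb, sub_zero,
      apply_ite (aug ℤ (FreeGroup X)), map_one, map_zero, smul_eq_mul, mul_ite, mul_one, mul_zero,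
      Finset.sum_ite_eq', Finset.mem_univ, if_true, sub_self]

lemma exists_endPow_idempotent_mod_six (φ : FreeGroup X →* FreeGroup X) : ∃ k, 1 ≤ k ∧
    ∀ j, ∃ u ∈ augPow X 1, (single (endPow φ k (endPow φ k (.of j))) 1 -
      single (endPow φ k (.of j)) 1 - (6 : ℤ) • u : MonoidAlgebra ℤ (FreeGroup X)) ∈
        augPow X 2 := by
  let M : ℕ → X → X → ZMod 6 := fun i j => expSum (endPow φ i (.of j))
  have hM : ∀ i i', M i = M i' → M (i + 1) = M (i' + 1) := by
    intro i i' h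
    funext j l
    simp only [M, endPow_succ_apply]
    rw [expSum_map, expSum_map]
    exact Finset.sum_congr rfl fun a _ => congrArg (· * _) (congrFun (congrFun h j) a)
  obtain ⟨i, q, hq, hiq⟩ : ∃ i q, 0 < q ∧ M (i + q) = M i := by
    obtain ⟨a, b, hab, h⟩ := Finite.exists_ne_map_eq_of_infinite M
    rcases lt_or_gt_of_ne hab with hlt | hlt
    · exact ⟨a, b - a, by omega, by rw [show a + (b - a) = b by omega, h]⟩
    · exact ⟨b, a - b, by omega, by rw [show b + (a - b) = a by omega, h]⟩
  have h1 : ∀ s, M (i + s + q) = M (i + s) := by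
    intro s
    induction s with
    | zero => exact hiq
    | succ s ih =>
      have := hM _ _ ih
      rwa [show i + s + q + 1 = i + (s + 1) + q by omega] at this
  have h2 : ∀ t s, M (i + s + q * t) = M (i + s) := by
    intro t
    induction t with
    | zero => intro s; rfl
    | succ t ih =>
      intro s
      have := h1 (s + q * t)
      rwa [show i + (s + q * t) + q = i + s + q * (t + 1) by ring, ← add_assoc, ih] at this
  have hk : i + 1 ≤ q * (i + 1) := Nat.le_mul_of_pos_left _ hq
  refine ⟨q * (i + 1), by omega, fun j => exists_sub_sub_smul_mem_augPow ?_⟩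
  rw [← endPow_add]
  have h3 := h2 (i + 1) (q * (i + 1) - i)
  rw [show i + (q * (i + 1) - i) = q * (i + 1) by omega] at h3
  exact congrFun h3 j

end ModSix

section FreeRank

/-- The group `G` is free on at most `n` generators. -/
def IsFreeOfRankLE (G : Type) [Group G] (n : ℕ) : Prop :=
  ∃ (X : Type) (_ : Fintype X), Fintype.card X ≤ n ∧ Nonempty (FreeGroup X ≃* G)

lemma IsFreeOfRankLE.of_equiv {G G' : Type} [Group G] [Group G'] {n : ℕ}
    (h : IsFreeOfRankLE G n) (e : G ≃* G') : IsFreeOfRankLE G' n := by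
  obtain ⟨X, hX, hn, ⟨e'⟩⟩ := h
  exact ⟨X, hX, hn, ⟨e'.trans e⟩⟩

lemma isFreeOfRankLE_of_forall {G : Type} [Group G] [IsFreeGroup G] {n : ℕ}
    (h : ∀ (Y : Type) (_ : FreeGroup Y ≃* G) (m : ℕ) (y : Fin m → Y), Function.Injective y →
      m ≤ n) : IsFreeOfRankLE G n := by
  have h' := h _ (IsFreeGroup.mulEquiv G)
  have hfin : Finite (IsFreeGroup.Generators G) := by
    by_contra hinf
    rw [not_finite_iff_infinite] at hinf
    have := h' (n + 1) (fun i => Infinite.natEmbedding _ i.1) fun a b hab =>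
      Fin.ext ((Infinite.natEmbedding _).injective hab)
    omega
  have := Fintype.ofFinite (IsFreeGroup.Generators G)
  exact ⟨_, this, h' _ _ (Fintype.equivFin _).symm.injective, ⟨IsFreeGroup.mulEquiv G⟩⟩

lemma IsFreeOfRankLE.exists_fg_rank_le {G : Type} [Group G] {n : ℕ} (h : IsFreeOfRankLE G n) :
    ∃ hfg : Group.FG G, @Group.rank _ _ hfg ≤ n := by
  classical
  obtain ⟨X, hX, hn, ⟨e⟩⟩ := h
  have hfg : Group.FG G := Group.fg_of_surjective (f := e.toMonoidHom) e.surjective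
  refine ⟨hfg, le_trans ?_ hn⟩
  refine (Group.rank_le (S := Finset.univ.image fun x => e (.of x)) ?_).trans Finset.card_image_le
  rw [Finset.coe_image, Finset.coe_univ, Set.image_univ, Set.range_comp' e, ← MulEquiv.coe_toMonoidHom, ← MonoidHom.map_closure,
    FreeGroup.closure_range_of, Subgroup.map_top_of_surjective _ e.surjective]

/-- The fixed subgroup of `φ` is the fixed subgroup of the restriction of `φ` to the fixed subgroup
of a power of `φ`. -/
lemma isFreeOfRankLE_fixedSubgroup_of_endPow {G : Type} [Group G] {n : ℕ} (φ : G →* G) (k : ℕ)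
    (h : ∀ ψ : fixedSubgroup (endPow φ k) →* fixedSubgroup (endPow φ k),
      (∀ x, endPow ψ k x = x) → IsFreeOfRankLE (fixedSubgroup ψ) n) :
    IsFreeOfRankLE (fixedSubgroup φ) n := by
  let N := fixedSubgroup (endPow φ k)
  let ψ : N →* N := (φ.comp N.subtype).codRestrict N fun x => by
    change endPow φ k (φ x) = φ x
    rw [← endPow_succ, endPow_succ_apply]
    exact congrArg φ x.2
  have hψ : ∀ i x, (endPow ψ i x : G) = endPow φ i x := by
    intro i
    induction i with
    | zero => exact fun _ => rfl
    | succ i ih => exact fun x => ih (ψ x)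
  refine (h ψ fun x => Subtype.ext ((hψ k x).trans x.2)).of_equiv
    { toFun := fun x => ⟨x.1.1, congrArg Subtype.val x.2⟩
      invFun := fun x => ⟨⟨x.1, endPow_eq_self x.2 k⟩, Subtype.ext x.2⟩
      left_inv := fun _ => rfl
      right_inv := fun _ => rfl
      map_mul' := fun _ _ => rfl }

lemma isFreeOfRankLE_fixedSubgroup_of_prime {G : Type} [Group G] {n p : ℕ} [Fact p.Prime]
    (hG : IsFreeOfRankLE G n) {σ : G →* G} (hσ : ∀ x, endPow σ p x = x) :
    IsFreeOfRankLE (fixedSubgroup σ) n := by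
  classical
  obtain ⟨X, hX, hn, ⟨e⟩⟩ := hG
  let σ' : FreeGroup X →* FreeGroup X := e.symm.toMonoidHom.comp (σ.comp e.toMonoidHom)
  have hσ' : ∀ i f, endPow σ' i f = e.symm (endPow σ i (e f)) := by
    intro i
    induction i with
    | zero => intro f; simp
    | succ i ih =>
      intro f
      rw [endPow_succ, ih, endPow_succ]
      simp [σ']
  have h1 : IsFreeOfRankLE (fixedSubgroup σ') n :=
    isFreeOfRankLE_of_forall fun Y e' m y hy => (card_le_of_endPow_prime (p := p)
      (fun f => by rw [hσ', hσ, e.symm_apply_apply]) (fun _ => Iff.rfl) e' hy).trans hn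
  refine h1.of_equiv
    { toFun := fun x => ⟨e x.1, ?_⟩
      invFun := fun x => ⟨e.symm x.1, ?_⟩
      left_inv := fun x => Subtype.ext (e.symm_apply_apply _)
      right_inv := fun x => Subtype.ext (e.apply_symm_apply _)
      map_mul' := fun x y => Subtype.ext (map_mul e _ _) }
  · exact e.symm.injective (x.2.trans (e.symm_apply_apply _).symm)
  · change e.symm (σ (e (e.symm x.1))) = _
    rw [e.apply_symm_apply, show σ x.1 = x.1 from x.2]

lemma isFreeOfRankLE_fixedSubgroup_of_finite_order {n : ℕ} (k : ℕ) (hk : 1 ≤ k) :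
    ∀ (G : Type) [Group G], IsFreeOfRankLE G n → ∀ φ : G →* G, (∀ x, endPow φ k x = x) →
      IsFreeOfRankLE (fixedSubgroup φ) n := by
  induction k using Nat.strong_induction_on with
  | _ k ih =>
    intro G _ hG φ hφ
    rcases hk.eq_or_lt with rfl | hk1
    · have : fixedSubgroup φ = ⊤ := top_unique fun x _ => hφ x
      rw [this]
      exact hG.of_equiv Subgroup.topEquiv.symm
    · have hp : Fact k.minFac.Prime := ⟨Nat.minFac_prime hk1.ne'⟩
      obtain ⟨k', hk'⟩ := k.minFac_dvd
      have hlt : k' < k := by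
        have := hp.out.two_le
        nlinarith
      have hpos : 1 ≤ k' := Nat.pos_of_ne_zero fun h => by simp [h] at hk'; omega
      refine isFreeOfRankLE_fixedSubgroup_of_endPow φ k' fun ψ hψ => ih k' hlt hpos _ ?_ ψ hψ
      refine isFreeOfRankLE_fixedSubgroup_of_prime (p := k.minFac) hG fun x => ?_
      rw [← endPow_mul, mul_comm, ← hk', hφ]

end FreeRank

/-- **Imrich–Turner.** For every endomorphism `φ` of the free group of rank `n`, the fixed
subgroup `Fix(φ)` is finitely generated of rank at most `n`. -/
theorem fixedSubgroup_of_freeGroup_rank_le (n : ℕ)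
    (φ : FreeGroup (Fin n) →* FreeGroup (Fin n)) :
    ∃ hfg : Group.FG ↥(fixedSubgroup φ), @Group.rank _ _ hfg ≤ n := by
  obtain ⟨k, hk, h6⟩ := exists_endPow_idempotent_mod_six φ
  refine (isFreeOfRankLE_fixedSubgroup_of_endPow φ k fun ψ hψ =>
    isFreeOfRankLE_fixedSubgroup_of_finite_order k hk _ ?_ ψ hψ).exists_fg_rank_le
  refine isFreeOfRankLE_of_forall fun Y e m y hy => ?_
  have := card_le_of_idempotent_mod_six h6 (fun _ => Iff.rfl) e hy
  rwa [Fintype.card_fin] at this
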